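/- arXiv:cs/0703079 — 2 statements merged into one kernel-verified Lean document; each statement's English description precedes it below -/
import Mathlib

section
/- For string languages (viewed as languages of monadic trees over Σ ∪ {⊥}, where each letter of Σ has rank 1 and ⊥ has rank 0), the regular languages coincide with the languages accepted by nondeterministic single-head two-way automata with nested pebbles and with the languages definable in first-order logic with unary deterministic transitive closure: REG = NPTWA^1 = FO+DTC^1. -/
namespace NestedPebbles

/-- Trees over a ranked alphabet `(Sig, rank)`: terms `σ(t₁,…,tₙ)` with `rank σ = n`. -/
inductive RTree (Sig : Type) (rank : Sig → ℕ) : Type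
  | node (a : Sig) (children : Fin (rank a) → RTree Sig rank) : RTree Sig rank

namespace RTree

variable {Sig : Type} {rank : Sig → ℕ}

/-- The label of the root symbol. -/
def label : RTree Sig rank → Sig
  | node a _ => a

/-- The `i`-th (0-based) immediate subtree, if it exists. -/
def child : RTree Sig rank → ℕ → Option (RTree Sig rank)
  | node a c, i => if h : i < rank a then some (c ⟨i, h⟩) else none

/-- The subtree at a position (a list of 0-based child indices, read from the root). -/
def subtree : RTree Sig rank → List ℕ → Option (RTree Sig rank)
  | t, [] => some t
  | t, i :: p => (t.child i).bind fun s => s.subtree p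

end RTree

variable {Sig : Type} {rank : Sig → ℕ}

/-- `p` is (the address of) a node of `t`. -/
def IsPos (t : RTree Sig rank) (p : List ℕ) : Prop := (t.subtree p).isSome = true

/-- The type of nodes of a tree `t`, as valid positions. -/
def Pos (t : RTree Sig rank) : Type := { p : List ℕ // IsPos t p }

/-- The root node. -/
def rootPos (t : RTree Sig rank) : Pos t := ⟨[], rfl⟩

/-- The label of the node of `t` at position `p`. -/
def labelAt (t : RTree Sig rank) (p : List ℕ) : Option Sig := (t.subtree p).map RTree.label

/-- The child number of a node: `0` for the root, and `j` for a `j`-th child (1-based). -/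
def childNo (p : List ℕ) : ℕ :=
  match p.getLast? with
  | none => 0
  | some j => j + 1

/-!  ### First-order logic with k-ary transitive closure, on trees  -/

/-- First-order formulas over a ranked alphabet, with a `k`-ary transitive closure
operator.  Variables are natural numbers.  `lab a x` means `x` has label `a`;
`edg i x y` means `y` is the `i`-th child of `x` (`i` is 1-based);
`le x y` means `x` is an ancestor of `y`; `tc xs ys φ us vs` is the transitive
closure `φ*` of `φ` with respect to the tuples of variables `xs`, `ys` (which it
binds), applied to the tuples of variables `us`, `vs`. -/
inductive TForm (Sig : Type) (rank : Sig → ℕ) (k : ℕ) : Type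
  | lab (a : Sig) (x : ℕ)
  | edg (i : ℕ) (x y : ℕ)
  | le (x y : ℕ)
  | eq (x y : ℕ)
  | not (φ : TForm Sig rank k)
  | and (φ ψ : TForm Sig rank k)
  | or (φ ψ : TForm Sig rank k)
  | ex (x : ℕ) (φ : TForm Sig rank k)
  | all (x : ℕ) (φ : TForm Sig rank k)
  | tc (xs ys : Fin k → ℕ) (φ : TForm Sig rank k) (us vs : Fin k → ℕ)

/-- Update a valuation on a tuple of variables simultaneously. -/
noncomputable def updVec {α : Type} {k : ℕ} (ν : ℕ → α) (xs : Fin k → ℕ) (a : Fin k → α) :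
    ℕ → α :=
  fun n => if h : ∃ i, xs i = n then a h.choose else ν n

/-- Satisfaction of a formula in a tree `t` under a valuation of the variables by
nodes of `t`. -/
def Sat {k : ℕ} (t : RTree Sig rank) : TForm Sig rank k → (ℕ → Pos t) → Prop
  | .lab a x, ν => labelAt t (ν x).1 = some a
  | .edg i x y, ν => 1 ≤ i ∧ (ν y).1 = (ν x).1 ++ [i - 1]
  | .le x y, ν => (ν x).1 <+: (ν y).1
  | .eq x y, ν => ν x = ν y
  | .not φ, ν => ¬ Sat t φ ν
  | .and φ ψ, ν => Sat t φ ν ∧ Sat t ψ ν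
  | .or φ ψ, ν => Sat t φ ν ∨ Sat t ψ ν
  | .ex x φ, ν => ∃ u : Pos t, Sat t φ (Function.update ν x u)
  | .all x φ, ν => ∀ u : Pos t, Sat t φ (Function.update ν x u)
  | .tc xs ys φ us vs, ν =>
      Relation.ReflTransGen
        (fun a b : Fin k → Pos t => Sat t φ (updVec (updVec ν xs a) ys b))
        (fun i => ν (us i)) (fun i => ν (vs i))

/-- The free variables of a formula. -/
def freeVars {k : ℕ} : TForm Sig rank k → Set ℕ
  | .lab _ x => {x}
  | .edg _ x y => {x, y}
  | .le x y => {x, y}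
  | .eq x y => {x, y}
  | .not φ => freeVars φ
  | .and φ ψ => freeVars φ ∪ freeVars ψ
  | .or φ ψ => freeVars φ ∪ freeVars ψ
  | .ex x φ => freeVars φ \ {x}
  | .all x φ => freeVars φ \ {x}
  | .tc xs ys φ us vs =>
      (freeVars φ \ (Set.range xs ∪ Set.range ys)) ∪ Set.range us ∪ Set.range vs

/-- Two `k`-tuples of variables consist of `2k` pairwise distinct variables. -/
def Distinct2 {k : ℕ} (xs ys : Fin k → ℕ) : Prop :=
  Function.Injective xs ∧ Function.Injective ys ∧ ∀ i j, xs i ≠ ys j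

/-- `φ` is functional in the tuples of variables `xs`, `ys`: for every tree, every
valuation of the remaining variables, and every value of `xs`, there is at most one
value of `ys` satisfying `φ`. -/
def FunctionalIn {k : ℕ} (φ : TForm Sig rank k) (xs ys : Fin k → ℕ) : Prop :=
  ∀ (t : RTree Sig rank) (ν : ℕ → Pos t) (a b b' : Fin k → Pos t),
    Sat t φ (updVec (updVec ν xs a) ys b) →
    Sat t φ (updVec (updVec ν xs a) ys b') → b = b'

/-- Well-formedness: in each transitive closure the `2k` bound variables are
pairwise distinct and occur free in the body. -/
def WF {k : ℕ} : TForm Sig rank k → Prop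
  | .not φ => WF φ
  | .and φ ψ => WF φ ∧ WF ψ
  | .or φ ψ => WF φ ∧ WF ψ
  | .ex _ φ => WF φ
  | .all _ φ => WF φ
  | .tc xs ys φ _ _ =>
      Distinct2 xs ys ∧ (Set.range xs ∪ Set.range ys) ⊆ freeVars φ ∧ WF φ
  | _ => True

/-- All transitive closures occurring in the formula are deterministic, i.e., applied
to functional formulas. -/
def DetTC {k : ℕ} : TForm Sig rank k → Prop
  | .not φ => DetTC φ
  | .and φ ψ => DetTC φ ∧ DetTC ψ
  | .or φ ψ => DetTC φ ∧ DetTC ψ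
  | .ex _ φ => DetTC φ
  | .all _ φ => DetTC φ
  | .tc xs ys φ _ _ => FunctionalIn φ xs ys ∧ DetTC φ
  | _ => True

/-- All occurrences of transitive closure are positive (within the scope of an even
number of negations); the polarity parameter `b` is `true` for an even number. -/
def PosTC {k : ℕ} : Bool → TForm Sig rank k → Prop
  | b, .not φ => PosTC (!b) φ
  | b, .and φ ψ => PosTC b φ ∧ PosTC b ψ
  | b, .or φ ψ => PosTC b φ ∧ PosTC b ψ
  | b, .ex _ φ => PosTC b φ
  | b, .all _ φ => PosTC b φ
  | b, .tc _ _ φ _ _ => b = true ∧ PosTC b φ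
  | _, _ => True

/-- The formula contains no transitive closure operator (pure first-order). -/
def TCFree {k : ℕ} : TForm Sig rank k → Prop
  | .not φ => TCFree φ
  | .and φ ψ => TCFree φ ∧ TCFree ψ
  | .or φ ψ => TCFree φ ∧ TCFree ψ
  | .ex _ φ => TCFree φ
  | .all _ φ => TCFree φ
  | .tc _ _ _ _ _ => False
  | _ => True

/-- The tree language defined by a (closed) formula. -/
def treesOf {k : ℕ} (φ : TForm Sig rank k) : Set (RTree Sig rank) :=
  {t | Sat t φ fun _ => rootPos t}

/-- `FO+DTC^k`: tree languages definable by closed first-order formulas with `k`-ary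
deterministic transitive closure. -/
def FODTC (Sig : Type) (rank : Sig → ℕ) (k : ℕ) : Set (Set (RTree Sig rank)) :=
  {L | ∃ φ : TForm Sig rank k, WF φ ∧ DetTC φ ∧ freeVars φ = ∅ ∧ L = treesOf φ}

/-- `FO+TC^k`: tree languages definable by closed first-order formulas with `k`-ary
transitive closure. -/
def FOTC (Sig : Type) (rank : Sig → ℕ) (k : ℕ) : Set (Set (RTree Sig rank)) :=
  {L | ∃ φ : TForm Sig rank k, WF φ ∧ freeVars φ = ∅ ∧ L = treesOf φ}

/-- `FO+posTC^k`: tree languages definable by closed first-order formulas in which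
every occurrence of the `k`-ary transitive closure operator is positive. -/
def FOposTC (Sig : Type) (rank : Sig → ℕ) (k : ℕ) : Set (Set (RTree Sig rank)) :=
  {L | ∃ φ : TForm Sig rank k, WF φ ∧ PosTC true φ ∧ freeVars φ = ∅ ∧ L = treesOf φ}

/-!  ### k-head tree-walking automata with nested pebbles  -/

/-- Tests of a `k`-head tree-walking automaton with pebble set `X`:
label of the node under head `i`, presence of pebble `x` at head `i`, and
child number of the node under head `i`. -/
inductive TTest (Sig : Type) (k : ℕ) (X : Type) : Type
  | lab (i : Fin k) (a : Sig)
  | peb (i : Fin k) (x : X)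
  | chno (i : Fin k) (j : ℕ)

/-- Instructions: move head `i` up / down to the `j`-th child (1-based), drop a
pebble at head `i`, retrieve the most recently dropped pebble (from a distance),
or perform a positive (`b = true`) or negated (`b = false`) test. -/
inductive TInstr (Sig : Type) (k : ℕ) (X : Type) : Type
  | up (i : Fin k)
  | down (i : Fin k) (j : ℕ)
  | dropPeb (i : Fin k) (x : X)
  | retrieve (x : X)
  | test (b : Bool) (τ : TTest Sig k X)

/-- A `k`-head tree-walking automaton with nested pebbles: a finite state set `Q`,
a finite pebble set `X`, an initial state, accepting states, and a finite set of
instructions `⟨p, χ, q⟩`. -/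
structure TWA (Sig : Type) (rank : Sig → ℕ) (k : ℕ) : Type 1 where
  Q : Type
  finQ : Fintype Q
  X : Type
  finX : Fintype X
  q0 : Q
  acc : Set Q
  instr : Set (Q × TInstr Sig k X × Q)
  instrFin : instr.Finite

/-- Configurations: a state, the positions of the `k` heads, and the stack of
dropped pebbles with their positions (most recent first). -/
abbrev TConf {Sig : Type} {rank : Sig → ℕ} {k : ℕ} (A : TWA Sig rank k)
    (t : RTree Sig rank) : Type :=
  A.Q × (Fin k → Pos t) × List (A.X × Pos t)

/-- Semantics of tests. -/
def testHolds {k : ℕ} (t : RTree Sig rank) {X : Type} (τ : TTest Sig k X)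
    (hs : Fin k → Pos t) (π : List (X × Pos t)) : Prop :=
  match τ with
  | .lab i a => labelAt t (hs i).1 = some a
  | .peb i x => (x, hs i) ∈ π
  | .chno i j => childNo (hs i).1 = j

/-- Semantics of a single instruction, relating head positions and pebble stacks
before and after. -/
def instrStep {k : ℕ} (t : RTree Sig rank) {X : Type} (ins : TInstr Sig k X)
    (hs : Fin k → Pos t) (π : List (X × Pos t))
    (hs' : Fin k → Pos t) (π' : List (X × Pos t)) : Prop :=
  match ins with
  | .up i => π' = π ∧ (∃ j : ℕ, (hs i).1 = (hs' i).1 ++ [j]) ∧ ∀ h, h ≠ i → hs' h = hs h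
  | .down i j => π' = π ∧ 1 ≤ j ∧ (hs' i).1 = (hs i).1 ++ [j - 1] ∧ ∀ h, h ≠ i → hs' h = hs h
  | .dropPeb i x => hs' = hs ∧ π' = (x, hs i) :: π ∧ ∀ w, (x, w) ∉ π
  | .retrieve x => hs' = hs ∧ ∃ w, π = (x, w) :: π'
  | .test b τ => hs' = hs ∧ π' = π ∧ (testHolds t τ hs π ↔ b = true)

/-- The step relation of automaton `A` on tree `t`. -/
def Step {k : ℕ} (A : TWA Sig rank k) (t : RTree Sig rank) :
    TConf A t → TConf A t → Prop :=
  fun c c' => ∃ ins : TInstr Sig k A.X,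
    (c.1, ins, c'.1) ∈ A.instr ∧ instrStep t ins c.2.1 c.2.2 c'.2.1 c'.2.2

/-- `χ'` is the negation of the test `χ`. -/
def negOf {k : ℕ} {X : Type} (χ χ' : TInstr Sig k X) : Prop :=
  ∃ b τ, χ = TInstr.test b τ ∧ χ' = TInstr.test (!b) τ

/-- Determinism: any two distinct instructions with the same source state consist
of a test and its negation. -/
def Deterministic {k : ℕ} (A : TWA Sig rank k) : Prop :=
  ∀ p χ₁ q₁ χ₂ q₂, (p, χ₁, q₁) ∈ A.instr → (p, χ₂, q₂) ∈ A.instr →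
    (χ₁, q₁) ≠ (χ₂, q₂) → negOf χ₁ χ₂ ∨ negOf χ₂ χ₁

/-- The initial configuration: initial state, all heads at the root, no pebbles. -/
def initConf {k : ℕ} (A : TWA Sig rank k) (t : RTree Sig rank) : TConf A t :=
  (A.q0, fun _ => rootPos t, [])

/-- A configuration is halting if no step is possible from it. -/
def HaltingConf {k : ℕ} (A : TWA Sig rank k) (t : RTree Sig rank) (c : TConf A t) : Prop :=
  ∀ c', ¬ Step A t c c'

/-- Acceptance: some computation from the initial configuration halts in an
accepting state with all heads at the root and no pebbles on the tree. -/
def Accepts {k : ℕ} (A : TWA Sig rank k) (t : RTree Sig rank) : Prop :=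
  ∃ q ∈ A.acc,
    Relation.ReflTransGen (Step A t) (initConf A t) (q, fun _ => rootPos t, []) ∧
    HaltingConf A t (q, fun _ => rootPos t, [])

/-- The tree language accepted by `A`. -/
def Lang {k : ℕ} (A : TWA Sig rank k) : Set (RTree Sig rank) := {t | Accepts A t}

/-- The automaton uses no pebbles at all. -/
def PebbleFree {k : ℕ} (A : TWA Sig rank k) : Prop :=
  ∀ p χ q, (p, χ, q) ∈ A.instr →
    (∀ i x, χ ≠ TInstr.dropPeb i x) ∧ (∀ x, χ ≠ TInstr.retrieve x) ∧
    (∀ b i x, χ ≠ TInstr.test b (TTest.peb i x))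

/-- `DPTWA^k`: tree languages accepted by deterministic `k`-head tree-walking
automata with nested pebbles. -/
def DPTWA (Sig : Type) (rank : Sig → ℕ) (k : ℕ) : Set (Set (RTree Sig rank)) :=
  {L | ∃ A : TWA Sig rank k, Deterministic A ∧ L = Lang A}

/-- `NPTWA^k`: tree languages accepted by nondeterministic `k`-head tree-walking
automata with nested pebbles. -/
def NPTWA (Sig : Type) (rank : Sig → ℕ) (k : ℕ) : Set (Set (RTree Sig rank)) :=
  {L | ∃ A : TWA Sig rank k, L = Lang A}

/-- `NTWA^k`: tree languages accepted by nondeterministic `k`-head tree-walking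
automata without pebbles. -/
def NTWA (Sig : Type) (rank : Sig → ℕ) (k : ℕ) : Set (Set (RTree Sig rank)) :=
  {L | ∃ A : TWA Sig rank k, PebbleFree A ∧ L = Lang A}

end NestedPebbles

namespace NestedPebbles

/-- The ranked alphabet `Sig ∪ {⊥}` for strings: every letter of `Sig` has rank
`1`, and the extra endmarker `⊥` has rank `0`. -/
def srank (Sig : Type) : Sig ⊕ Unit → ℕ :=
  fun s => match s with
  | .inl _ => 1
  | .inr _ => 0

/-- The encoding of a string as a monadic tree over `Sig ∪ {⊥}`. -/
def encodeString {Sig : Type} : List Sig → RTree (Sig ⊕ Unit) (srank Sig)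
  | [] => .node (Sum.inr ()) (fun i => i.elim0)
  | a :: w => .node (Sum.inl a) (fun _ => encodeString w)

end NestedPebbles

namespace NestedPebbles

section Kit

theorem isRegular_rel {α β : Type} (r : β → α → Prop) {K : Language α} (hK : K.IsRegular) :
    Language.IsRegular ({z | ∃ z' ∈ K, List.Forall₂ r z z'} : Set (List β)) := by
  obtain ⟨σ, _, M, rfl⟩ := hK
  let N : NFA β σ := ⟨fun s b => {s' | ∃ a, r b a ∧ s' = M.step s a}, {M.start}, M.accept⟩
  refine ⟨Set σ, inferInstance, N.toDFA, ?_⟩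
  rw [NFA.toDFA_correct]
  have key : ∀ (z : List β) (S : Set σ) (s' : σ), s' ∈ N.evalFrom S z ↔
      ∃ s ∈ S, ∃ z', List.Forall₂ r z z' ∧ M.evalFrom s z' = s' := by
    intro z
    induction z with
    | nil => intro S s'; simp
    | cons b z ih =>
      intro S s'
      rw [NFA.evalFrom_cons, ih]
      constructor
      · rintro ⟨s, hs, z', hz, rfl⟩
        rw [NFA.mem_stepSet] at hs
        obtain ⟨t, ht, a, hra, rfl⟩ := hs
        exact ⟨t, ht, a :: z', .cons hra hz, rfl⟩
      · rintro ⟨s, hs, z', hz, rfl⟩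
        cases hz with
        | cons hra hz =>
          rename_i a z'
          refine ⟨M.step s a, ?_, z', hz, rfl⟩
          rw [NFA.mem_stepSet]
          exact ⟨s, hs, a, hra, rfl⟩
  ext z
  rw [NFA.mem_accepts]
  constructor
  · rintro ⟨s, hs, h⟩
    obtain ⟨s0, h0, z', hz, rfl⟩ := (key _ _ _).1 h
    cases h0
    exact ⟨z', hs, hz⟩
  · rintro ⟨z', h, hz⟩
    exact ⟨_, h, (key _ _ _).2 ⟨_, rfl, z', hz, rfl⟩⟩

theorem isRegular_comap {α β : Type} (f : β → α) {K : Language α} (hK : K.IsRegular) :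
    Language.IsRegular ({z | z.map f ∈ K} : Set (List β)) := by
  obtain ⟨σ, _, M, rfl⟩ := hK
  exact ⟨σ, inferInstance, M.comap f, by rw [DFA.accepts_comap]; rfl⟩

theorem isRegular_exL {α : Type} (S : Set α) :
    Language.IsRegular ({z | ∃ a ∈ z, a ∈ S} : Set (List α)) := by
  let M : DFA α Prop := ⟨fun s a => s ∨ a ∈ S, False, {s | s}⟩
  refine ⟨Prop, inferInstance, M, ?_⟩
  have key : ∀ z, M.eval z = ∃ a ∈ z, a ∈ S := by
    intro z
    induction z using List.reverseRecOn with
    | nil => simp [M]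
    | append_singleton z a ih =>
      rw [DFA.eval_append_singleton, ih]
      simp only [M, List.mem_append, List.mem_singleton, eq_iff_iff]
      constructor
      · rintro (⟨b, hb, h⟩ | h)
        · exact ⟨b, .inl hb, h⟩
        · exact ⟨a, .inr rfl, h⟩
      · rintro ⟨b, hb | rfl, h⟩
        · exact .inl ⟨b, hb, h⟩
        · exact .inr h
  ext z
  rw [DFA.mem_accepts, key]
  rfl

theorem isRegular_pwL {α : Type} (S T : Set α) :
    Language.IsRegular ({z | z.Pairwise fun a b => ¬ (a ∈ S ∧ b ∈ T)} : Set (List α)) := by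
  let M : DFA α (Prop × Prop) :=
    ⟨fun s a => (s.1 ∨ a ∈ S, s.2 ∧ ¬ (s.1 ∧ a ∈ T)), (False, True), {s | s.2}⟩
  refine ⟨Prop × Prop, inferInstance, M, ?_⟩
  have key : ∀ z, M.eval z =
      ((∃ a ∈ z, a ∈ S), z.Pairwise fun a b => ¬ (a ∈ S ∧ b ∈ T)) := by
    intro z
    induction z using List.reverseRecOn with
    | nil => simp [M]
    | append_singleton z a ih =>
      rw [DFA.eval_append_singleton, ih]
      simp only [M, List.mem_append, List.mem_singleton, Prod.mk.injEq, eq_iff_iff,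
        List.pairwise_append, List.pairwise_singleton]
      constructor
      · constructor
        · rintro (⟨b, hb, h⟩ | h)
          · exact ⟨b, .inl hb, h⟩
          · exact ⟨a, .inr rfl, h⟩
        · rintro ⟨b, hb | rfl, h⟩
          · exact .inl ⟨b, hb, h⟩
          · exact .inr h
      · constructor
        · rintro ⟨h1, h2⟩
          refine ⟨h1, trivial, ?_⟩
          rintro b hb c rfl ⟨h3, h4⟩
          exact h2 ⟨⟨b, hb, h3⟩, h4⟩
        · rintro ⟨h1, -, h2⟩
          refine ⟨h1, ?_⟩
          rintro ⟨⟨b, hb, h3⟩, h4⟩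
          exact h2 b hb a rfl ⟨h3, h4⟩
  ext z
  rw [DFA.mem_accepts, key]
  rfl

theorem forall2_range {α β : Type} [Inhabited α] (r : β → α → Prop) (N : ℕ) (f : ℕ → β)
    (z' : List α) : List.Forall₂ r ((List.range N).map f) z' ↔
      ∃ g : ℕ → α, z' = (List.range N).map g ∧ ∀ i < N, r (f i) (g i) := by
  rw [List.forall₂_iff_get]
  constructor
  · rintro ⟨hl, h⟩
    refine ⟨fun i => z'.getD i default, ?_, ?_⟩
    · apply List.ext_getElem
      · simpa using hl.symm
      · intro i h1 h2
        simp [List.getElem?_eq_getElem h1]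
    · intro i hi
      have h2 : i < z'.length := by rw [← hl]; simpa using hi
      have := h i (by simpa using hi) h2
      simpa [List.getElem?_eq_getElem h2] using this
  · rintro ⟨g, rfl, h⟩
    refine ⟨by simp, ?_⟩
    intro i h1 h2
    simpa using h i (by simpa using h1)

variable {Sig V U : Type}

/-- Marked letters. -/
abbrev Mk (Sig V U : Type) : Type := Option Sig × (V → Prop) × (U → Prop)

/-- Word with markings. -/
def enc (w : List Sig) (p : V → ℕ) (X : U → ℕ → Prop) : List (Mk Sig V U) :=
  (List.range (w.length + 1)).map fun i => (w[i]?, (fun v => p v = i), fun u => X u i)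

/-- Recognizable predicates. -/
def DefP (P : List Sig → (V → ℕ) → (U → ℕ → Prop) → Prop) : Prop :=
  ∃ K : Language (Mk Sig V U), K.IsRegular ∧
    ∀ w p X, (∀ v, p v ≤ w.length) → (P w p X ↔ enc w p X ∈ K)

theorem DefP.congr {P Q : List Sig → (V → ℕ) → (U → ℕ → Prop) → Prop} (h : DefP P)
    (hPQ : ∀ w p X, (∀ v, p v ≤ w.length) → (Q w p X ↔ P w p X)) : DefP Q := by
  obtain ⟨K, hK, h⟩ := h
  exact ⟨K, hK, fun w p X hp => (hPQ w p X hp).trans (h w p X hp)⟩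

theorem DefP.not {P : List Sig → (V → ℕ) → (U → ℕ → Prop) → Prop} (h : DefP P) :
    DefP fun w p X => ¬ P w p X := by
  obtain ⟨K, hK, h⟩ := h
  exact ⟨Kᶜ, hK.compl, fun w p X hp => not_congr (h w p X hp)⟩

theorem DefP.and {P Q : List Sig → (V → ℕ) → (U → ℕ → Prop) → Prop} (h : DefP P) (h' : DefP Q) :
    DefP fun w p X => P w p X ∧ Q w p X := by
  obtain ⟨K, hK, h⟩ := h
  obtain ⟨K', hK', h'⟩ := h'
  exact ⟨K ⊓ K', hK.inf hK', fun w p X hp => and_congr (h w p X hp) (h' w p X hp)⟩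

theorem DefP.or {P Q : List Sig → (V → ℕ) → (U → ℕ → Prop) → Prop} (h : DefP P) (h' : DefP Q) :
    DefP fun w p X => P w p X ∨ Q w p X :=
  (h.not.and h'.not).not.congr fun w p X _ => by tauto

theorem DefP.imp {P Q : List Sig → (V → ℕ) → (U → ℕ → Prop) → Prop} (h : DefP P) (h' : DefP Q) :
    DefP fun w p X => P w p X → Q w p X :=
  (h.and h'.not).not.congr fun w p X _ => by tauto

theorem DefP.tt : DefP fun (_ : List Sig) (_ : V → ℕ) (_ : U → ℕ → Prop) => True := by
  refine ⟨⊤, ?_, fun w p X _ => ⟨fun _ => trivial, fun _ => trivial⟩⟩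
  have h := isRegular_exL (∅ : Set (Mk Sig V U))
  have h2 := h.compl
  convert h2
  ext z
  constructor
  · rintro - ⟨a, -, h⟩
    exact h
  · intro _; trivial

theorem DefP.const (c : Prop) : DefP fun (_ : List Sig) (_ : V → ℕ) (_ : U → ℕ → Prop) => c := by
  by_cases hc : c
  · exact DefP.tt.congr fun w p X _ => by simp [hc]
  · exact DefP.tt.not.congr fun w p X _ => by simp [hc]

theorem DefP.reindex {V' U' : Type} {P : List Sig → (V → ℕ) → (U → ℕ → Prop) → Prop}
    (h : DefP P) (f : V → V') (g : U → U') :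
    DefP fun w (p : V' → ℕ) (X : U' → ℕ → Prop) => P w (p ∘ f) (X ∘ g) := by
  obtain ⟨K, hK, h⟩ := h
  refine ⟨_, isRegular_comap (fun a : Mk Sig V' U' => ((a.1, a.2.1 ∘ f, a.2.2 ∘ g) : Mk Sig V U)) hK,
    fun w p X hp => (h w (p ∘ f) (X ∘ g) fun v => hp _).trans ?_⟩
  have : enc w (p ∘ f) (X ∘ g) =
      (enc w p X).map (fun a : Mk Sig V' U' => ((a.1, a.2.1 ∘ f, a.2.2 ∘ g) : Mk Sig V U)) := by
    simp only [enc, List.map_map]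
    rfl
  rw [this]
  rfl

theorem DefP.exSet {W : Type} {P : List Sig → (V → ℕ) → (U ⊕ W → ℕ → Prop) → Prop}
    (h : DefP P) :
    DefP fun w (p : V → ℕ) (X : U → ℕ → Prop) => ∃ Y : W → ℕ → Prop, P w p (Sum.elim X Y) := by
  obtain ⟨K, hK, h⟩ := h
  refine ⟨_, isRegular_rel (fun (b : Mk Sig V U) (a : Mk Sig V (U ⊕ W)) =>
    b.1 = a.1 ∧ b.2.1 = a.2.1 ∧ b.2.2 = a.2.2 ∘ Sum.inl) hK, fun w p X hp => ?_⟩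
  constructor
  · rintro ⟨Y, hY⟩
    refine ⟨_, (h w p _ hp).1 hY, ?_⟩
    have : Inhabited (Mk Sig V (U ⊕ W)) := ⟨(none, fun _ => True, fun _ => True)⟩
    refine (forall2_range _ _ _ _).2 ⟨_, rfl, ?_⟩
    intro i _
    exact ⟨rfl, rfl, rfl⟩
  · rintro ⟨z', hz', hf⟩
    have : Inhabited (Mk Sig V (U ⊕ W)) := ⟨(none, fun _ => True, fun _ => True)⟩
    obtain ⟨g, rfl, hg⟩ := (forall2_range _ _ _ _).1 hf
    refine ⟨fun v i => (g i).2.2 (Sum.inr v), (h w p _ hp).2 ?_⟩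
    convert hz' using 1
    refine List.map_congr_left fun i hi => ?_
    obtain ⟨h1, h2, h3⟩ := hg i (by simpa using hi)
    refine Prod.ext h1 (Prod.ext h2 ?_)
    funext v
    cases v with
    | inl v => exact congrFun h3 v
    | inr v => rfl

/-- Extend a first order valuation. -/
def ext1 (p : V → ℕ) (i : ℕ) : Option V → ℕ := fun o => o.elim i p

@[simp] theorem ext1_none (p : V → ℕ) (i : ℕ) : ext1 p i none = i := rfl
@[simp] theorem ext1_some (p : V → ℕ) (i : ℕ) (v : V) : ext1 p i (some v) = p v := rfl

theorem DefP.ex {P : List Sig → (Option V → ℕ) → (U → ℕ → Prop) → Prop}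
    (h : DefP P) :
    DefP fun w (p : V → ℕ) (X : U → ℕ → Prop) => ∃ i ≤ w.length, P w (ext1 p i) X := by
  obtain ⟨K, hK, h⟩ := h
  let S : Set (Mk Sig (Option V) U) := {a | a.2.1 none}
  have hK2 := (hK.inf (isRegular_exL S)).inf (isRegular_pwL S S)
  refine ⟨_, isRegular_rel (fun (b : Mk Sig V U) (a : Mk Sig (Option V) U) =>
    b.1 = a.1 ∧ b.2.1 = a.2.1 ∘ some ∧ b.2.2 = a.2.2) hK2, fun w p X hp => ?_⟩
  have : Inhabited (Mk Sig (Option V) U) := ⟨(none, fun _ => True, fun _ => True)⟩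
  constructor
  · rintro ⟨i, hi, hY⟩
    refine ⟨_, ⟨⟨(h w (ext1 p i) _ ?_).1 hY, ?_⟩, ?_⟩, ?_⟩
    · rintro (_ | v)
      · exact hi
      · exact hp v
    · exact ⟨_, List.mem_map.2 ⟨i, by simpa [Nat.lt_succ_iff] using hi, rfl⟩, rfl⟩
    · refine List.pairwise_map.2 ?_
      refine (List.pairwise_lt_range).imp ?_
      rintro a b hab ⟨h1, h2⟩
      have h1 : i = a := h1
      have h2 : i = b := h2
      omega
    refine (forall2_range _ _ _ _).2 ⟨_, rfl, ?_⟩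
    intro i _
    exact ⟨rfl, rfl, rfl⟩
  · rintro ⟨z', ⟨⟨hz', hz1⟩, hz2⟩, hf⟩
    obtain ⟨g, rfl, hg⟩ := (forall2_range _ _ _ _).1 hf
    obtain ⟨a, ha, haS⟩ := hz1
    obtain ⟨i, hi, rfl⟩ := List.mem_map.1 ha
    have hi' : i < w.length + 1 := by simpa using hi
    refine ⟨i, by omega, (h w _ _ ?_).2 ?_⟩
    · rintro (_ | v)
      · simp only [ext1_none]; omega
      · exact hp v
    have hun : ∀ j < w.length + 1, g j ∈ S → i = j := by
      intro j hj hjS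
      have hz2 : List.Pairwise _ _ := hz2
      rw [List.pairwise_iff_getElem] at hz2
      rcases lt_trichotomy i j with hlt | rfl | hlt
      · exact absurd (by rw [List.getElem_map, List.getElem_map, List.getElem_range, List.getElem_range]; exact ⟨haS, hjS⟩) (hz2 i j (by simpa using hi') (by simpa using hj) hlt)
      · rfl
      · exact absurd (by rw [List.getElem_map, List.getElem_map, List.getElem_range, List.getElem_range]; exact ⟨hjS, haS⟩) (hz2 j i (by simpa using hj) (by simpa using hi') hlt)
    have hz' : List.map g (List.range (w.length + 1)) ∈ K := hz'
    suffices hs : enc w (ext1 p i) X = List.map g (List.range (w.length + 1)) by rwa [hs]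
    refine List.map_congr_left fun j hj => ?_
    have hj' : j < w.length + 1 := by simpa using hj
    obtain ⟨h1, h2, h3⟩ := hg j hj'
    refine Prod.ext h1 (Prod.ext ?_ h3)
    funext v
    cases v with
    | none =>
      apply propext
      constructor
      · rintro h0
        have h0 : i = j := h0
        subst h0
        exact haS
      · exact hun j hj'
    | some v => exact congrFun h2 v

theorem DefP.all {P : List Sig → (Option V → ℕ) → (U → ℕ → Prop) → Prop}
    (h : DefP P) :
    DefP fun w (p : V → ℕ) (X : U → ℕ → Prop) => ∀ i ≤ w.length, P w (ext1 p i) X :=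
  h.not.ex.not.congr fun w p X _ => by push Not; rfl

theorem DefP.allSet {W : Type} {P : List Sig → (V → ℕ) → (U ⊕ W → ℕ → Prop) → Prop}
    (h : DefP P) :
    DefP fun w (p : V → ℕ) (X : U → ℕ → Prop) => ∀ Y : W → ℕ → Prop, P w p (Sum.elim X Y) :=
  h.not.exSet.not.congr fun w p X _ => by push Not; rfl

theorem DefP.exFin {I : Type} {s : Set I} (hs : s.Finite)
    {P : I → List Sig → (V → ℕ) → (U → ℕ → Prop) → Prop}
    (h : ∀ i ∈ s, DefP (P i)) : DefP fun w p X => ∃ i ∈ s, P i w p X := by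
  induction s, hs using Set.Finite.induction_on with
  | empty => exact (DefP.const False).congr fun w p X _ => by simp
  | insert _ _ ih =>
    exact ((h _ (Set.mem_insert _ _)).or (ih fun i hi => h i (Set.mem_insert_of_mem _ hi))).congr
      fun w p X _ => by simp

theorem DefP.exFinite {I : Type} [Finite I]
    {P : I → List Sig → (V → ℕ) → (U → ℕ → Prop) → Prop}
    (h : ∀ i, DefP (P i)) : DefP fun w p X => ∃ i, P i w p X :=
  (DefP.exFin (Set.toFinite Set.univ) fun i _ => h i).congr fun w p X _ => by simp

theorem DefP.allFinite {I : Type} [Finite I]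
    {P : I → List Sig → (V → ℕ) → (U → ℕ → Prop) → Prop}
    (h : ∀ i, DefP (P i)) : DefP fun w p X => ∀ i, P i w p X :=
  (DefP.exFinite fun i => (h i).not).not.congr fun w p X _ => by push Not; rfl

theorem DefP.at (v : V) (S : Set (Mk Sig V U)) :
    DefP fun w p X => ((w[p v]?, (fun v' => p v' = p v), fun u => X u (p v)) : Mk Sig V U) ∈ S := by
  refine ⟨_, isRegular_exL {a : Mk Sig V U | a.2.1 v ∧ a ∈ S}, fun w p X hp => ?_⟩
  constructor
  · intro h
    exact ⟨_, List.mem_map.2 ⟨p v, by simpa [Nat.lt_succ_iff] using hp v, rfl⟩, rfl, h⟩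
  · rintro ⟨a, ha, h1, h2⟩
    obtain ⟨i, hi, rfl⟩ := List.mem_map.1 ha
    have h1 : p v = i := h1
    subst h1
    exact h2

theorem DefP.mem (u : U) (v : V) : DefP fun (_ : List Sig) p X => X u (p v) :=
  DefP.at v {a : Mk Sig V U | a.2.2 u}

theorem DefP.eq (v v' : V) : DefP fun (_ : List Sig) p (_ : U → ℕ → Prop) => p v = p v' :=
  DefP.at v' {a : Mk Sig V U | a.2.1 v}

theorem DefP.lab (o : Option Sig) (v : V) :
    DefP fun (w : List Sig) p (_ : U → ℕ → Prop) => w[p v]? = o :=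
  DefP.at v {a : Mk Sig V U | a.1 = o}

theorem DefP.lt (v v' : V) : DefP fun (_ : List Sig) p (_ : U → ℕ → Prop) => p v < p v' := by
  refine ⟨_, (isRegular_pwL {a : Mk Sig V U | a.2.1 v} {a : Mk Sig V U | a.2.1 v'}).compl,
    fun w p X hp => ?_⟩
  have key : (p v < p v') ↔ ¬ (enc w p X).Pairwise
      fun a b => ¬ (a ∈ {a : Mk Sig V U | a.2.1 v} ∧ b ∈ {a : Mk Sig V U | a.2.1 v'}) := by
    rw [enc, List.pairwise_map, List.pairwise_iff_getElem]
    constructor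
    · intro h h2
      refine h2 (p v) (p v') (by simpa [Nat.lt_succ_iff] using hp v)
        (by simpa [Nat.lt_succ_iff] using hp v') h ?_
      simp
    · intro h
      by_contra hn
      apply h
      intro i j hi hj hij
      simp only [List.getElem_range, Set.mem_ofPred_eq]
      omega
  exact key

theorem DefP.le (v v' : V) : DefP fun (_ : List Sig) p (_ : U → ℕ → Prop) => p v ≤ p v' :=
  (DefP.lt v' v).not.congr fun w p X _ => by simp

theorem DefP.succ (v v' : V) :
    DefP fun (_ : List Sig) p (_ : U → ℕ → Prop) => p v' = p v + 1 := by
  have h : DefP fun (_ : List Sig) (p : V → ℕ) (_ : U → ℕ → Prop) => p v < p v' := DefP.lt v v'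
  have h2 := (((DefP.lt (some v) none).and (DefP.lt none (some v')) :
    DefP fun (_ : List Sig) (p : Option V → ℕ) (_ : U → ℕ → Prop) => _)).ex.not
  refine (h.and h2).congr fun w p X hp => ?_
  simp only [ext1_none, ext1_some]
  constructor
  · rintro h
    refine ⟨by omega, ?_⟩
    rintro ⟨i, _, _, _⟩
    omega
  · rintro ⟨h1, h2⟩
    by_contra hn
    exact h2 ⟨p v + 1, by have := hp v'; omega, by omega, by omega⟩

theorem DefP.isZero (v : V) :
    DefP fun (_ : List Sig) p (_ : U → ℕ → Prop) => p v = 0 := by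
  have h2 := ((DefP.lt none (some v) :
    DefP fun (_ : List Sig) (p : Option V → ℕ) (_ : U → ℕ → Prop) => _)).ex.not
  refine h2.congr fun w p X hp => ?_
  simp only [ext1_none, ext1_some]
  constructor
  · rintro h ⟨i, _, _⟩
    omega
  · intro h
    by_contra hn
    exact h ⟨0, by omega, by omega⟩

/-- Transfer a recognizable predicate without free variables to a language. -/
theorem DefP.isRegular {P : List Sig → Prop}
    (h : DefP fun (w : List Sig) (_ : Empty → ℕ) (_ : Empty → ℕ → Prop) => P w) :
    Language.IsRegular ({w | P w} : Set (List Sig)) := by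
  obtain ⟨K, hK, h⟩ := h
  -- append the end marker, then drop it
  obtain ⟨σ, _, M, rfl⟩ := hK
  let f : Option Sig → Mk Sig Empty Empty := fun a => (a, Empty.elim, Empty.elim)
  let M' : DFA Sig σ := ⟨fun s a => M.step s (f (some a)), M.start, {s | M.step s (f none) ∈ M.accept}⟩
  refine ⟨σ, inferInstance, M', ?_⟩
  have he : ∀ w : List Sig, enc w (Empty.elim : Empty → ℕ) (Empty.elim : Empty → ℕ → Prop) =
      w.map (fun a => f (some a)) ++ [f none] := by
    intro w
    unfold enc
    rw [List.range_succ, List.map_append]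
    congr 1
    · apply List.ext_getElem
      · simp
      · intro i h1 h2
        have : i < w.length := by simpa using h1
        simp only [List.getElem_map, List.getElem_range, f]
        refine Prod.ext ?_ (Prod.ext (funext fun x => x.elim) (funext fun x => x.elim))
        simp [this]
    · simp only [List.map_cons, List.map_nil, f, List.cons.injEq, and_true]
      refine Prod.ext ?_ (Prod.ext (funext fun x => x.elim) (funext fun x => x.elim))
      simp
  have hev : ∀ (w : List Sig) s, M'.evalFrom s w = M.evalFrom s (w.map fun a => f (some a)) := by
    intro w
    induction w with
    | nil => intro s; rfl
    | cons a w ih => intro s; exact ih _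
  ext w
  refine Iff.trans ?_ (h w Empty.elim Empty.elim (fun v => v.elim)).symm
  rw [he, DFA.mem_accepts, DFA.mem_accepts, DFA.eval_append_singleton]
  have := hev w M.start
  show M'.evalFrom M.start w ∈ _ ↔ _
  rw [this]
  rfl

end Kit
end NestedPebbles

namespace NestedPebbles

section Trees
variable {Sig : Type}

theorem subtree_encode (w : List Sig) (p : List ℕ) :
    (encodeString w).subtree p =
      if p = List.replicate p.length 0 ∧ p.length ≤ w.length
      then some (encodeString (w.drop p.length)) else none := by
  induction p generalizing w with
  | nil => simp [RTree.subtree]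
  | cons i p ih =>
    cases w with
    | nil => simp [RTree.subtree, encodeString, RTree.child, srank]
    | cons a w =>
      rcases Nat.eq_zero_or_pos i with rfl | hi
      · simp [RTree.subtree, encodeString, RTree.child, srank, ih, List.replicate_succ]
      · have : ¬ i < 1 := by omega
        have h0 : i ≠ 0 := by omega
        simp [RTree.subtree, encodeString, RTree.child, srank, List.replicate_succ, this, h0]

theorem isPos_encode (w : List Sig) (p : List ℕ) :
    IsPos (encodeString w) p ↔ p = List.replicate p.length 0 ∧ p.length ≤ w.length := by
  unfold IsPos
  rw [subtree_encode]
  split_ifs with h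
  · exact ⟨fun _ => h, fun _ => rfl⟩
  · exact ⟨fun h' => (by cases h'), fun h' => absurd h' h⟩

/-- The `i`-th position of the tree of a string. -/
def toPos (w : List Sig) (i : ℕ) : Pos (encodeString w) :=
  ⟨List.replicate (min i w.length) 0, by rw [isPos_encode]; simp⟩

theorem toPos_val (w : List Sig) {i : ℕ} (hi : i ≤ w.length) :
    (toPos w i).1 = List.replicate i 0 := by
  simp [toPos, hi]

theorem exists_toPos (w : List Sig) (u : Pos (encodeString w)) : ∃ i ≤ w.length, u = toPos w i := by
  obtain ⟨p, hp⟩ := u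
  obtain ⟨h1, h2⟩ := (isPos_encode w p).1 hp
  exact ⟨p.length, h2, Subtype.ext (by rw [toPos_val w h2]; exact h1)⟩

theorem toPos_inj (w : List Sig) {i j : ℕ} (hi : i ≤ w.length) (hj : j ≤ w.length) :
    toPos w i = toPos w j ↔ i = j := by
  constructor
  · intro h
    have := congrArg (fun u : Pos (encodeString w) => u.1.length) h
    simpa [toPos_val w hi, toPos_val w hj] using this
  · rintro rfl; rfl

theorem rootPos_eq (w : List Sig) : rootPos (encodeString w) = toPos w 0 :=
  Subtype.ext (by rw [toPos_val w (Nat.zero_le _)]; rfl)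

theorem exPos_iff (w : List Sig) (P : Pos (encodeString w) → Prop) :
    (∃ u, P u) ↔ ∃ i ≤ w.length, P (toPos w i) := by
  constructor
  · rintro ⟨u, hu⟩
    obtain ⟨i, hi, rfl⟩ := exists_toPos w u
    exact ⟨i, hi, hu⟩
  · rintro ⟨i, -, h⟩
    exact ⟨_, h⟩

theorem allPos_iff (w : List Sig) (P : Pos (encodeString w) → Prop) :
    (∀ u, P u) ↔ ∀ i ≤ w.length, P (toPos w i) := by
  constructor
  · intro h i _
    exact h _
  · intro h u
    obtain ⟨i, hi, rfl⟩ := exists_toPos w u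
    exact h i hi

theorem label_toPos (w : List Sig) {i : ℕ} (hi : i ≤ w.length) :
    labelAt (encodeString w) (toPos w i).1 = some (w[i]?.elim (Sum.inr ()) Sum.inl) := by
  rw [toPos_val w hi, labelAt, subtree_encode]
  simp only [List.length_replicate, hi, and_self, if_true, Option.map_some]
  congr 1
  rcases Nat.lt_or_ge i w.length with h | h
  · rw [List.drop_eq_getElem_cons h, List.getElem?_eq_getElem h]
    rfl
  · rw [List.drop_eq_nil_of_le h, List.getElem?_eq_none h]
    rfl

theorem label_inl_iff (w : List Sig) {i : ℕ} (hi : i ≤ w.length) (a : Sig) :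
    labelAt (encodeString w) (toPos w i).1 = some (Sum.inl a) ↔ w[i]? = some a := by
  rw [label_toPos w hi]
  cases h : w[i]? <;> simp

theorem label_inr_iff (w : List Sig) {i : ℕ} (hi : i ≤ w.length) (a : Unit) :
    labelAt (encodeString w) (toPos w i).1 = some (Sum.inr a) ↔ w[i]? = none := by
  rw [label_toPos w hi]
  cases h : w[i]? <;> simp

theorem edge_iff (w : List Sig) {i j : ℕ} (hi : i ≤ w.length) (hj : j ≤ w.length) (k : ℕ) :
    (toPos w j).1 = (toPos w i).1 ++ [k] ↔ k = 0 ∧ j = i + 1 := by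
  rw [toPos_val w hi, toPos_val w hj]
  constructor
  · intro h
    have h1 : j = i + 1 := by simpa using congrArg List.length h
    subst h1
    refine ⟨?_, rfl⟩
    rw [List.replicate_succ'] at h
    simpa using h.symm
  · rintro ⟨rfl, rfl⟩
    rw [List.replicate_succ']

theorem le_iff (w : List Sig) {i j : ℕ} (hi : i ≤ w.length) (hj : j ≤ w.length) :
    (toPos w i).1 <+: (toPos w j).1 ↔ i ≤ j := by
  rw [toPos_val w hi, toPos_val w hj]
  constructor
  · intro h
    simpa using h.length_le
  · intro h
    refine ⟨List.replicate (j - i) 0, ?_⟩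
    rw [List.replicate_append_replicate]
    congr 1
    omega

theorem childNo_toPos (w : List Sig) {i : ℕ} (hi : i ≤ w.length) :
    childNo (toPos w i).1 = if i = 0 then 0 else 1 := by
  rw [toPos_val w hi]
  unfold childNo
  cases i with
  | zero => rfl
  | succ i => simp [List.replicate_succ']

theorem encode_injective : Function.Injective (encodeString (Sig := Sig)) := by
  intro w
  induction w with
  | nil =>
    intro w' h
    cases w' with
    | nil => rfl
    | cons b w' =>
      have := congrArg RTree.label h
      simp [encodeString, RTree.label] at this
  | cons a w ih =>
    intro w' h
    cases w' with
    | nil =>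
      have := congrArg RTree.label h
      simp [encodeString, RTree.label] at this
    | cons b w' =>
      have h1 := congrArg RTree.label h
      have h2 := congrArg (fun t => t.child 0) h
      simp [encodeString, RTree.label] at h1
      simp [encodeString, RTree.child, srank] at h2
      rw [h1, ih h2]

theorem encode_surjective : Function.Surjective (encodeString (Sig := Sig)) := by
  intro t
  induction t with
  | node a c ih =>
    cases a with
    | inl a =>
      obtain ⟨w, hw⟩ := ih ⟨0, Nat.one_pos⟩
      refine ⟨a :: w, ?_⟩
      simp only [encodeString]
      congr 1
      funext i
      rw [hw]
      congr 1
      exact Subsingleton.elim (α := Fin 1) _ _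
    | inr a =>
      refine ⟨[], ?_⟩
      simp only [encodeString]
      congr 1
      funext i
      exact i.elim0

theorem rtg_iff {α : Type} (r : α → α → Prop) (a b : α) :
    Relation.ReflTransGen r a b ↔
      ∀ Y : α → Prop, Y a → (∀ c d, Y c → r c d → Y d) → Y b := by
  constructor
  · intro h Y ha hc
    induction h with
    | refl => exact ha
    | tail _ h ih => exact hc _ _ ih h
  · intro h
    exact h (Relation.ReflTransGen r a) .refl fun c d => .tail

theorem updVec_one {α : Type} (ν : ℕ → α) (xs : Fin 1 → ℕ) (a : Fin 1 → α) :
    updVec ν xs a = Function.update ν (xs 0) (a 0) := by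
  funext n
  unfold updVec
  split_ifs with h
  · obtain ⟨i, hi⟩ := h
    have : xs 0 = n := by rw [← hi, Subsingleton.elim i 0]
    subst this
    rw [Function.update_self, Subsingleton.elim (Exists.choose _) 0]
  · have : n ≠ xs 0 := fun hn => h ⟨0, hn.symm⟩
    rw [Function.update_of_ne this]

theorem satDef (φ : TForm (Sig ⊕ Unit) (srank Sig) 1) : ∀ U : Type,
    DefP fun (w : List Sig) (p : ℕ → ℕ) (_ : U → ℕ → Prop) =>
      Sat (encodeString w) φ (toPos w ∘ p) := by
  induction φ with
  | lab a x =>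
    intro U
    cases a with
    | inl a => exact (DefP.lab (some a) x).congr fun w p X hp => label_inl_iff w (hp x) a
    | inr a => exact (DefP.lab none x).congr fun w p X hp => label_inr_iff w (hp x) a
  | edg i x y =>
    intro U
    refine ((DefP.const (1 ≤ i ∧ i - 1 = 0)).and (DefP.succ x y)).congr fun w p X hp => ?_
    simp only [Sat, Function.comp]
    rw [edge_iff w (hp x) (hp y)]
    tauto
  | le x y =>
    intro U
    exact (DefP.le x y).congr fun w p X hp => le_iff w (hp x) (hp y)
  | eq x y =>
    intro U
    exact (DefP.eq x y).congr fun w p X hp => toPos_inj w (hp x) (hp y)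
  | not φ ih => intro U; exact (ih U).not
  | and φ ψ ih1 ih2 => intro U; exact (ih1 U).and (ih2 U)
  | or φ ψ ih1 ih2 => intro U; exact (ih1 U).or (ih2 U)
  | ex x φ ih =>
    intro U
    refine ((ih U).reindex (fun y => if y = x then none else some y) id).ex.congr
      fun w p X hp => ?_
    simp only [Sat]
    rw [exPos_iff]
    refine exists_congr fun i => and_congr_right fun hi => iff_of_eq (congrArg _ ?_)
    funext y
    by_cases hy : y = x <;> simp [Function.update, hy]
  | all x φ ih =>
    intro U
    refine ((ih U).reindex (fun y => if y = x then none else some y) id).all.congr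
      fun w p X hp => ?_
    simp only [Sat]
    rw [allPos_iff]
    refine forall_congr' fun i => forall_congr' fun hi => iff_of_eq (congrArg _ ?_)
    funext y
    by_cases hy : y = x <;> simp [Function.update, hy]
  | tc xs ys φ us vs ih =>
    intro U
    have hb : DefP fun (w : List Sig) (p : Option (Option ℕ) → ℕ) (X : U ⊕ Unit → ℕ → Prop) =>
        X (.inr ()) (p (some none)) → 
          Sat (encodeString w) φ (toPos w ∘ (p ∘ fun v => if v = ys 0 then none else
            if v = xs 0 then some none else some (some v))) → X (.inr ()) (p none) :=
      (DefP.mem _ _).imp (((ih (U ⊕ Unit)).reindex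
        (fun v => if v = ys 0 then none else
            if v = xs 0 then some none else some (some v)) id).imp (DefP.mem _ _))
    have hb2 := (((DefP.mem (.inr ()) (us 0)).imp (hb.all.all.imp
      (DefP.mem (.inr ()) (vs 0)))) ).allSet
    refine hb2.congr fun w p X hp => ?_
    simp only [Sat, updVec_one]
    have hupd : ∀ i j, (toPos w ∘ (ext1 (ext1 p i) j ∘ fun v => if v = ys 0 then none else
            if v = xs 0 then some none else some (some v))) =
            Function.update (Function.update (toPos w ∘ p) (xs 0) (toPos w i)) (ys 0) (toPos w j) := by
      intro i j
      funext v
      by_cases h1 : v = ys 0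
      · simp [Function.update, h1]
      · by_cases h2 : v = xs 0
        · subst h2; simp [Function.update, h1]
        · simp [Function.update, h1, h2]
    simp only [hupd, ext1_some, ext1_none, Sum.elim_inr]
    rw [rtg_iff]
    constructor
    · intro h Y h0 hc
      have := h (fun c => ∃ i ≤ w.length, c = (fun _ => toPos w i) ∧ Y () i)
        ⟨p (us 0), hp _, by funext i; rw [Subsingleton.elim i 0]; rfl, h0⟩ ?_
      · obtain ⟨i, hi, he, hY⟩ := this
        have he := congrFun he 0
        have he : toPos w (p (vs 0)) = toPos w i := he
        rw [toPos_inj w (hp _) hi] at he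
        rwa [he]
      · rintro c d ⟨i, hi, rfl, hY⟩ hs
        obtain ⟨j, hj, hd⟩ := exists_toPos w (d 0)
        refine ⟨j, hj, ?_, ?_⟩
        · funext k
          rw [Subsingleton.elim k 0, hd]
        · rw [hd] at hs
          exact hc i hi j hj hY hs
    · intro h Y h0 hc
      have h00 : Y fun _ => toPos w (p (us 0)) := by
        convert h0 using 2 with i
        rw [Subsingleton.elim i 0]; rfl
      have := h (fun _ i => Y fun _ => toPos w i) h00 ?_
      · convert this using 2 with i
        rw [Subsingleton.elim i 0]; rfl
      · intro i hi j hj hYi hs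
        exact hc _ _ hYi hs

theorem fodtc_regular (L : Set (List Sig))
    (h : encodeString '' L ∈ FODTC (Sig ⊕ Unit) (srank Sig) 1) :
    Language.IsRegular (L : Language Sig) := by
  obtain ⟨φ, -, -, -, hL⟩ := h
  have h1 := (satDef φ Empty).reindex (fun _ => (none : Option Empty)) id
  have h2 := ((DefP.isZero none).and h1).ex
  have h3 : DefP fun (w : List Sig) (_ : Empty → ℕ) (_ : Empty → ℕ → Prop) => w ∈ L := by
    refine h2.congr fun w p X hp => ?_
    rw [← encode_injective.mem_set_image, hL]
    constructor
    · intro h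
      refine ⟨0, Nat.zero_le _, rfl, ?_⟩
      have h : Sat (encodeString w) φ fun _ => rootPos _ := h
      rw [rootPos_eq] at h
      exact h
    · rintro ⟨i, -, h0, h⟩
      have h0 : i = 0 := h0
      subst h0
      show Sat (encodeString w) φ fun _ => rootPos _
      rw [rootPos_eq]
      exact h
  exact h3.isRegular

end Trees
end NestedPebbles

namespace NestedPebbles

section Pebbles
variable {Sig : Type} (A : TWA (Sig ⊕ Unit) (srank Sig) 1)

/-- Semantics of tests on string positions. -/
def smpTest {X : Type} (w : List Sig) (m : X → Option ℕ) (τ : TTest (Sig ⊕ Unit) 1 X) (u : ℕ) :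
    Prop :=
  match τ with
  | .lab _ a => labelAt (encodeString w) (toPos w u).1 = some a
  | .peb _ x => m x = some u
  | .chno _ j => (if u = 0 then 0 else 1) = j

/-- Semantics of instructions that do not change the stack. -/
def smp {X : Type} (w : List Sig) (m : X → Option ℕ) (ins : TInstr (Sig ⊕ Unit) 1 X) (u v : ℕ) :
    Prop :=
  match ins with
  | .up _ => u = v + 1
  | .down _ j => j = 1 ∧ v = u + 1
  | .test b τ => v = u ∧ (smpTest w m τ u ↔ b = true)
  | .dropPeb _ _ => False
  | .retrieve _ => False

/-- Big step relation, relative to a reachability relation for one more pebble. -/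
def BS (w : List Sig) (R : (A.X → Option ℕ) → A.Q × ℕ → A.Q × ℕ → Prop) (m : A.X → Option ℕ)
    (c d : A.Q × ℕ) : Prop :=
  c.2 ≤ w.length ∧ d.2 ≤ w.length ∧
    ((∃ ins, (c.1, ins, d.1) ∈ A.instr ∧ smp w m ins c.2 d.2) ∨
     ∃ (x : A.X) (q1 q2 : A.Q) (i : Fin 1), (c.1, TInstr.dropPeb i x, q1) ∈ A.instr ∧
      m x = none ∧ (q2, TInstr.retrieve x, d.1) ∈ A.instr ∧
      open Classical in R (Function.update m x (some c.2)) (q1, c.2) (q2, d.2))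

/-- Reachability using at most `d` more pebbles. -/
def RD (w : List Sig) : ℕ → (A.X → Option ℕ) → A.Q × ℕ → A.Q × ℕ → Prop
  | 0, m => Relation.ReflTransGen (BS A w (fun _ _ _ => False) m)
  | d + 1, m => Relation.ReflTransGen (BS A w (RD w d) m)

theorem smpTest_def {X V U : Type} (τ : TTest (Sig ⊕ Unit) 1 X) (m : X → Option V) (u : V) :
    DefP fun (w : List Sig) (p : V → ℕ) (_ : U → ℕ → Prop) =>
      smpTest w (fun x => (m x).map p) τ (p u) := by
  cases τ with
  | lab i a =>
    cases a with
    | inl a => exact (DefP.lab (some a) u).congr fun w p X hp => label_inl_iff w (hp u) a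
    | inr a => exact (DefP.lab none u).congr fun w p X hp => label_inr_iff w (hp u) a
  | peb i x =>
    cases h : m x with
    | none => exact (DefP.const False).congr fun w p X hp => by simp [smpTest, h]
    | some v => exact (DefP.eq v u).congr fun w p X hp => by simp [smpTest, h]
  | chno i j =>
    refine (((DefP.isZero u).and (DefP.const (0 = j))).or
      ((DefP.isZero u).not.and (DefP.const (1 = j)))).congr fun w p X hp => ?_
    unfold smpTest
    by_cases h : p u = 0 <;> simp [h]

theorem smp_def {X V U : Type} (ins : TInstr (Sig ⊕ Unit) 1 X) (m : X → Option V) (u v : V) :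
    DefP fun (w : List Sig) (p : V → ℕ) (_ : U → ℕ → Prop) =>
      smp w (fun x => (m x).map p) ins (p u) (p v) := by
  cases ins with
  | up i => exact DefP.succ v u
  | down i j => exact (DefP.const (j = 1)).and (DefP.succ u v)
  | test b τ =>
    cases b with
    | true =>
      refine ((DefP.eq v u).and (smpTest_def τ m u)).congr fun w p X hp => ?_
      simp [smp]
    | false =>
      refine ((DefP.eq v u).and (smpTest_def τ m u).not).congr fun w p X hp => ?_
      simp [smp]
  | dropPeb i x => exact DefP.const False
  | retrieve x => exact DefP.const False

theorem BS_def {R : List Sig → (A.X → Option ℕ) → A.Q × ℕ → A.Q × ℕ → Prop}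
    (hR : ∀ (V U : Type) (q q' : A.Q) (m : A.X → Option V) (u v : V),
      DefP fun (w : List Sig) (p : V → ℕ) (_ : U → ℕ → Prop) =>
        R w (fun x => (m x).map p) (q, p u) (q', p v))
    (V U : Type) (q q' : A.Q) (m : A.X → Option V) (u v : V) :
      DefP fun (w : List Sig) (p : V → ℕ) (_ : U → ℕ → Prop) =>
        BS A w (R w) (fun x => (m x).map p) (q, p u) (q', p v) := by
  classical
  have := A.finQ
  have := A.finX
  have h1 : DefP fun (w : List Sig) (p : V → ℕ) (_ : U → ℕ → Prop) => ∃ e ∈ A.instr,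
      (e.1 = q ∧ e.2.2 = q') ∧ smp w (fun x => (m x).map p) e.2.1 (p u) (p v) :=
    DefP.exFin A.instrFin fun e _ => (DefP.const _).and (smp_def _ _ _ _)
  have h2 : DefP fun (w : List Sig) (p : V → ℕ) (_ : U → ℕ → Prop) =>
      ∃ e : A.X × A.Q × A.Q × Fin 1, ((q, TInstr.dropPeb e.2.2.2 e.1, e.2.1) ∈ A.instr ∧
        m e.1 = none ∧ (e.2.2.1, TInstr.retrieve e.1, q') ∈ A.instr) ∧
        R w (fun x => (Function.update m e.1 (some u) x).map p) (e.2.1, p u) (e.2.2.1, p v) :=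
    DefP.exFinite fun e => (DefP.const _).and (hR _ _ _ _ _ _ _)
  refine (h1.or h2).congr fun w p X hp => ?_
  unfold BS
  simp only [hp, true_and]
  refine or_congr ?_ ?_
  · constructor
    · rintro ⟨ins, h, h'⟩
      exact ⟨_, h, ⟨rfl, rfl⟩, h'⟩
    · rintro ⟨⟨_, ins, _⟩, h, ⟨rfl, rfl⟩, h'⟩
      exact ⟨ins, h, h'⟩
  · have hu : ∀ x, (fun x' => (Function.update m x (some u) x').map p) =
        Function.update (fun x => (m x).map p) x (some (p u)) := by
      intro x
      funext x'
      by_cases hx : x' = x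
      · subst hx; simp
      · simp [hx]
    constructor
    · rintro ⟨x, q1, q2, i, ha, hb, hc, hd⟩
      refine ⟨(x, q1, q2, i), ⟨ha, by simpa using hb, hc⟩, ?_⟩
      simp only [hu]
      convert hd
    · rintro ⟨⟨x, q1, q2, i⟩, ⟨ha, hb, hc⟩, hd⟩
      simp only [hu] at hd
      refine ⟨x, q1, q2, i, ha, by simp [hb], hc, ?_⟩
      convert hd

theorem rtg_def {B : List Sig → (A.X → Option ℕ) → A.Q × ℕ → A.Q × ℕ → Prop}
    (hbd : ∀ w m c d, B w m c d → c.2 ≤ w.length ∧ d.2 ≤ w.length)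
    (hB : ∀ (V U : Type) (q q' : A.Q) (m : A.X → Option V) (u v : V),
      DefP fun (w : List Sig) (p : V → ℕ) (_ : U → ℕ → Prop) =>
        B w (fun x => (m x).map p) (q, p u) (q', p v))
    (V U : Type) (q q' : A.Q) (m : A.X → Option V) (u v : V) :
      DefP fun (w : List Sig) (p : V → ℕ) (_ : U → ℕ → Prop) =>
        Relation.ReflTransGen (B w (fun x => (m x).map p)) (q, p u) (q', p v) := by
  have := A.finQ
  have h1 : ∀ e : A.Q × A.Q, DefP fun (w : List Sig) (p : Option (Option V) → ℕ)
      (X : U ⊕ A.Q → ℕ → Prop) => X (.inr e.1) (p (some none)) →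
        B w (fun x => ((m x).map (fun v => some (some v))).map p) (e.1, p (some none)) (e.2, p none) →
        X (.inr e.2) (p none) :=
    fun e => (DefP.mem _ _).imp ((hB _ _ _ _ _ _ _).imp (DefP.mem _ _))
  have h2 := ((DefP.mem (.inr q) u).imp
    ((DefP.allFinite fun e => (h1 e).all.all).imp (DefP.mem (.inr q') v))).allSet
  refine h2.congr fun w p X hp => ?_
  simp only [Sum.elim_inr, ext1_none, ext1_some, Option.map_map]
  have hc : ∀ i j, ((ext1 (ext1 p i) j) ∘ fun v => some (some v)) = p := fun i j => rfl
  simp only [hc]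
  rw [rtg_iff]
  constructor
  · intro h Y h0 hcl
    exact h (fun c => Y c.1 c.2) h0 fun c d hY hs =>
      hcl (c.1, d.1) c.2 (hbd _ _ _ _ hs).1 d.2 (hbd _ _ _ _ hs).2 hY hs
  · intro h Y h0 hcl
    exact h (fun a i => Y (a, i)) h0 fun e i hi j hj hY hs => hcl _ _ hY hs

theorem RD_def (d : ℕ) : ∀ (V U : Type) (q q' : A.Q) (m : A.X → Option V) (u v : V),
      DefP fun (w : List Sig) (p : V → ℕ) (_ : U → ℕ → Prop) =>
        RD A w d (fun x => (m x).map p) (q, p u) (q', p v) := by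
  induction d with
  | zero =>
    exact rtg_def A (B := fun w => BS A w fun _ _ _ => False) (fun w m c d h => ⟨h.1, h.2.1⟩)
      (BS_def A (R := fun _ _ _ _ => False) fun _ _ _ _ _ _ _ => DefP.const False)
  | succ d ih =>
    exact rtg_def A (B := fun w => BS A w (RD A w d)) (fun w m c d h => ⟨h.1, h.2.1⟩)
      (BS_def A (R := fun w => RD A w d) ih)

/-- Pebble positions given by a stack. -/
noncomputable def mOf {X : Type} {w : List Sig} :
    List (X × Pos (encodeString w)) → X → Option ℕ
  | [] => fun _ => none
  | e :: π => open Classical in Function.update (mOf π) e.1 (some e.2.1.length)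

/-- Pebble names in the stack. -/
abbrev keys {X : Type} {w : List Sig} (π : List (X × Pos (encodeString w))) : List X :=
  π.map Prod.fst

variable {A}

theorem toPos_length (w : List Sig) {i : ℕ} (hi : i ≤ w.length) : (toPos w i).1.length = i := by
  rw [toPos_val w hi, List.length_replicate]

theorem mOf_none {X : Type} {w : List Sig} (π : List (X × Pos (encodeString w))) (x : X) :
    mOf π x = none ↔ x ∉ keys π := by
  classical
  induction π with
  | nil => simp [mOf]
  | cons e π ih =>
    by_cases h : x = e.1
    · subst h; simp [mOf]
    · simp only [mOf, Function.update_of_ne h, ih]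
      simp [h]

theorem mem_keys {X : Type} {w : List Sig} (π : List (X × Pos (encodeString w))) (x : X) :
    (∀ u, (x, u) ∉ π) ↔ x ∉ keys π := by
  simp [keys]

theorem mOf_some {X : Type} {w : List Sig} (π : List (X × Pos (encodeString w)))
    (hn : (keys π).Nodup) (x : X) {u : ℕ} (hu : u ≤ w.length) :
    mOf π x = some u ↔ (x, toPos w u) ∈ π := by
  classical
  induction π with
  | nil => simp [mOf]
  | cons e π ih =>
    have hn' : e.1 ∉ keys π ∧ (keys π).Nodup := List.nodup_cons.1 hn
    obtain ⟨i, hi, he⟩ := exists_toPos w e.2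
    by_cases h : x = e.1
    · subst h
      simp only [mOf, Function.update_self, Option.some.injEq, List.mem_cons]
      have hnm := (mem_keys π e.1).2 hn'.1 (toPos w u)
      simp only [hnm, or_false]
      rw [he, toPos_length w hi]
      constructor
      · rintro rfl
        exact Prod.ext rfl he.symm
      · intro h
        have := congrArg Prod.snd h
        simp only [he] at this
        exact ((toPos_inj w hu hi).1 this).symm
    · simp only [mOf, Function.update_of_ne h, ih hn'.2, List.mem_cons]
      constructor
      · exact .inr
      · rintro (h' | h')
        · exact absurd (congrArg Prod.fst h') h
        · exact h'

theorem test_iff {X : Type} {w : List Sig} (π : List (X × Pos (encodeString w)))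
    (hn : (keys π).Nodup) (τ : TTest (Sig ⊕ Unit) 1 X) {u : ℕ} (hu : u ≤ w.length) :
    testHolds (encodeString w) τ (fun _ => toPos w u) π ↔ smpTest w (mOf π) τ u := by
  cases τ with
  | lab i a => rfl
  | peb i x => exact (mOf_some π hn x hu).symm
  | chno i j => simp only [testHolds, smpTest, childNo_toPos w hu]

theorem fun1_ext {α : Type} (f : Fin 1 → α) (a : α) (h : f 0 = a) : f = fun _ => a := by
  funext i
  rw [Subsingleton.elim i 0, h]

theorem fun1_inj {α : Type} {a b : α} : ((fun _ : Fin 1 => a) = fun _ => b) ↔ a = b :=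
  ⟨fun h => congrFun h 0, fun h => by rw [h]⟩

theorem instr_smp {X : Type} {w : List Sig} (π : List (X × Pos (encodeString w)))
    (hn : (keys π).Nodup) (ins : TInstr (Sig ⊕ Unit) 1 X) {u v : ℕ} (hu : u ≤ w.length)
    (hv : v ≤ w.length) (h : smp w (mOf π) ins u v) :
    instrStep (encodeString w) ins (fun _ => toPos w u) π (fun _ => toPos w v) π := by
  cases ins with
  | up i =>
    refine ⟨rfl, ⟨0, (edge_iff w hv hu 0).2 ⟨rfl, h⟩⟩, fun k hk => absurd (Subsingleton.elim _ _) hk⟩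
  | down i j =>
    obtain ⟨rfl, h⟩ := h
    exact ⟨rfl, le_rfl, (edge_iff w hu hv 0).2 ⟨rfl, h⟩, fun k hk => absurd (Subsingleton.elim _ _) hk⟩
  | dropPeb i x => exact h.elim
  | retrieve x => exact h.elim
  | test b τ =>
    obtain ⟨rfl, h⟩ := h
    exact ⟨rfl, rfl, by rw [test_iff π hn τ hu]; exact h⟩

theorem instr_cases {X : Type} {w : List Sig} (π π' : List (X × Pos (encodeString w)))
    (hn : (keys π).Nodup) (ins : TInstr (Sig ⊕ Unit) 1 X) {u v : ℕ} (hu : u ≤ w.length)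
    (hv : v ≤ w.length)
    (h : instrStep (encodeString w) ins (fun _ => toPos w u) π (fun _ => toPos w v) π') :
    (π' = π ∧ smp w (mOf π) ins u v) ∨
    (∃ i x, ins = .dropPeb i x ∧ v = u ∧ π' = (x, toPos w u) :: π ∧ x ∉ keys π) ∨
    (∃ x y, ins = .retrieve x ∧ v = u ∧ π = (x, y) :: π') := by
  cases ins with
  | up i =>
    obtain ⟨h1, ⟨j, h2⟩, -⟩ := h
    exact .inl ⟨h1, ((edge_iff w hv hu j).1 h2).2⟩
  | down i j =>
    obtain ⟨h1, h2, h3, -⟩ := h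
    have := (edge_iff w hu hv (j - 1)).1 h3
    exact .inl ⟨h1, by omega, this.2⟩
  | dropPeb i x =>
    obtain ⟨h1, h2, h3⟩ := h
    rw [fun1_inj, toPos_inj w hv hu] at h1
    exact .inr (.inl ⟨i, x, rfl, h1, h2, (mem_keys _ _).1 h3⟩)
  | retrieve x =>
    obtain ⟨h1, y, h2⟩ := h
    rw [fun1_inj, toPos_inj w hv hu] at h1
    exact .inr (.inr ⟨x, y, rfl, h1, h2⟩)
  | test b τ =>
    obtain ⟨h1, h2, h3⟩ := h
    rw [fun1_inj, toPos_inj w hv hu] at h1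
    exact .inl ⟨h2, h1, by rw [← test_iff π hn τ hu]; exact h3⟩

theorem BS_sound {w : List Sig} (R : (A.X → Option ℕ) → A.Q × ℕ → A.Q × ℕ → Prop)
    (hR : ∀ (π : List (A.X × Pos (encodeString w))) c d, (keys π).Nodup → R (mOf π) c d →
      Relation.ReflTransGen (Step A (encodeString w))
        (c.1, (fun _ => toPos w c.2), π) (d.1, (fun _ => toPos w d.2), π))
    (π : List (A.X × Pos (encodeString w))) (c d : A.Q × ℕ) (hn : (keys π).Nodup)
    (h : Relation.ReflTransGen (BS A w R (mOf π)) c d) :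
    Relation.ReflTransGen (Step A (encodeString w))
        (c.1, (fun _ => toPos w c.2), π) (d.1, (fun _ => toPos w d.2), π) := by
  induction h with
  | refl => exact .refl
  | @tail b c' _ hb ih =>
    refine ih.trans ?_
    obtain ⟨hc, hd, ⟨ins, hi, hs⟩ | ⟨x, q1, q2, i, h1, h2, h3, h4⟩⟩ := hb
    · exact .single ⟨ins, hi, instr_smp π hn ins hc hd hs⟩
    · have hx := (mOf_none π x).1 h2
      have hm : mOf ((x, toPos w b.2) :: π) = open Classical in
          Function.update (mOf π) x (some b.2) := by
        simp only [mOf, toPos_length w hc]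
      rw [← hm] at h4
      have h5 := hR ((x, toPos w b.2) :: π) _ _ (List.nodup_cons.2 ⟨hx, hn⟩) h4
      refine (Relation.ReflTransGen.head ?_ h5).tail ?_
      · exact ⟨_, h1, rfl, rfl, (mem_keys _ _).2 hx⟩
      · exact ⟨_, h3, rfl, _, rfl⟩

theorem RD_sound {w : List Sig} (n : ℕ) :
    ∀ (π : List (A.X × Pos (encodeString w))) (c d : A.Q × ℕ), (keys π).Nodup →
    RD A w n (mOf π) c d →
    Relation.ReflTransGen (Step A (encodeString w))
        (c.1, (fun _ => toPos w c.2), π) (d.1, (fun _ => toPos w d.2), π) := by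
  induction n with
  | zero => exact fun π c d hn h => BS_sound (fun _ _ _ => False) (fun _ _ _ _ h => h.elim) π c d hn h
  | succ n ih => exact fun π c d hn h => BS_sound (RD A w n) ih π c d hn h

/-- Invariant of reachable configurations. -/
noncomputable def Inv (A : TWA (Sig ⊕ Unit) (srank Sig) 1) (w : List Sig) (N : ℕ) :
    List (A.X × Pos (encodeString w)) → A.Q → ℕ → Prop
  | [], q, h => RD A w N (mOf (w := w) []) (A.q0, 0) (q, h)
  | e :: π, q, h => ∃ q1 i q1' u, u ≤ w.length ∧ e.2 = toPos w u ∧ Inv A w N π q1 u ∧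
      (q1, TInstr.dropPeb i e.1, q1') ∈ A.instr ∧
      RD A w (N - (π.length + 1)) (mOf (e :: π)) (q1', u) (q, h)

theorem RD_smp {w : List Sig} {n : ℕ} {m : A.X → Option ℕ} {c : A.Q × ℕ} {q q' : A.Q} {u v : ℕ}
    (h : RD A w n m c (q, u)) (hu : u ≤ w.length) (hv : v ≤ w.length)
    {ins} (hi : (q, ins, q') ∈ A.instr) (hs : smp w m ins u v) : RD A w n m c (q', v) := by
  cases n with
  | zero => exact Relation.ReflTransGen.tail h ⟨hu, hv, .inl ⟨ins, hi, hs⟩⟩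
  | succ n => exact Relation.ReflTransGen.tail h ⟨hu, hv, .inl ⟨ins, hi, hs⟩⟩

theorem RD_refl {w : List Sig} {n : ℕ} {m : A.X → Option ℕ} {c : A.Q × ℕ} : RD A w n m c c := by
  cases n with
  | zero => exact .refl
  | succ n => exact .refl

theorem RD_big {w : List Sig} {n : ℕ} {m : A.X → Option ℕ} {c d e : A.Q × ℕ}
    (h : RD A w (n + 1) m c d) (hb : BS A w (RD A w n) m d e) : RD A w (n + 1) m c e :=
  Relation.ReflTransGen.tail h hb

theorem Inv_smp {w : List Sig} {N : ℕ} (π : List (A.X × Pos (encodeString w)))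
    {q q' : A.Q} {u v : ℕ}
    (h : Inv A w N π q u) (hu : u ≤ w.length) (hv : v ≤ w.length)
    {ins} (hi : (q, ins, q') ∈ A.instr) (hs : smp w (mOf π) ins u v) : Inv A w N π q' v := by
  cases π with
  | nil => exact RD_smp h hu hv hi hs
  | cons e π =>
    obtain ⟨q1, i, q1', u', h1, h2, h3, h4, h5⟩ := h
    exact ⟨q1, i, q1', u', h1, h2, h3, h4, RD_smp h5 hu hv hi hs⟩

theorem Inv_big {w : List Sig} {N : ℕ} (π : List (A.X × Pos (encodeString w)))
    {q q' : A.Q} {u v : ℕ} (hN : π.length < N)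
    (h : Inv A w N π q u) (hb : BS A w (RD A w (N - (π.length + 1))) (mOf π) (q, u) (q', v)) :
    Inv A w N π q' v := by
  cases π with
  | nil =>
    obtain ⟨n, rfl⟩ : ∃ n, N = n + 1 := ⟨N - 1, by simp at hN; omega⟩
    exact RD_big h hb
  | cons e π =>
    obtain ⟨q1, i, q1', u', h1, h2, h3, h4, h5⟩ := h
    refine ⟨q1, i, q1', u', h1, h2, h3, h4, ?_⟩
    simp only [List.length_cons] at hN hb
    obtain ⟨n, hn⟩ : ∃ n, N - (π.length + 1) = n + 1 := ⟨N - (π.length + 1) - 1, by omega⟩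
    have hn' : N - (π.length + 1 + 1) = n := by omega
    rw [hn] at h5 ⊢
    rw [hn'] at hb
    exact RD_big h5 hb

theorem Inv_step [Fintype A.X] {w : List Sig}
    {q q' : A.Q} {u : ℕ} (hu : u ≤ w.length) {π π' : List (A.X × Pos (encodeString w))}
    {hs' : Fin 1 → Pos (encodeString w)}
    (hn : (keys π).Nodup) (h : Inv A w (Fintype.card A.X) π q u)
    (hs : Step A (encodeString w) (q, (fun _ => toPos w u), π) (q', hs', π')) :
    ∃ v ≤ w.length, (hs' = fun _ => toPos w v) ∧ (keys π').Nodup ∧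
      Inv A w (Fintype.card A.X) π' q' v := by
  obtain ⟨v, hv, hv'⟩ := exists_toPos w (hs' 0)
  have hh := fun1_ext _ _ hv'
  subst hh
  refine ⟨v, hv, rfl, ?_⟩
  obtain ⟨ins, hi, hst⟩ := hs
  rcases instr_cases π π' hn ins hu hv hst with ⟨rfl, h1⟩ | ⟨i, x, rfl, rfl, rfl, hx⟩ |
    ⟨x, y, rfl, rfl, rfl⟩
  · exact ⟨hn, Inv_smp _ h hu hv hi h1⟩
  · exact ⟨List.nodup_cons.2 ⟨hx, hn⟩, q, i, q', v, hv, rfl, h, hi, RD_refl⟩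
  · have hn' : x ∉ keys π' ∧ (keys π').Nodup := List.nodup_cons.1 hn
    refine ⟨hn'.2, ?_⟩
    have hlen : π'.length < Fintype.card A.X := by
      have := hn.length_le_card
      simpa using this
    obtain ⟨q1, i, q1', u', h1, h2, h3, h4, h5⟩ := h
    refine Inv_big π' hlen h3 ⟨h1, hv, .inr ⟨x, q1', q, i, h4, (mOf_none _ _).2 hn'.1, hi, ?_⟩⟩
    have hy : y = toPos w u' := h2
    subst hy
    simpa only [mOf, toPos_length w h1] using h5

theorem reach_iff [Fintype A.X] (w : List Sig) (q : A.Q) :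
    Relation.ReflTransGen (Step A (encodeString w)) (initConf A (encodeString w))
      (q, (fun _ => rootPos _), []) ↔
    RD A w (Fintype.card A.X) (fun _ => none) (A.q0, 0) (q, 0) := by
  constructor
  · intro h
    have key : ∀ c, Relation.ReflTransGen (Step A (encodeString w)) (initConf A (encodeString w)) c →
        ∃ v ≤ w.length, (c.2.1 = fun _ => toPos w v) ∧ (keys c.2.2).Nodup ∧
          Inv A w (Fintype.card A.X) c.2.2 c.1 v := by
      intro c hc
      induction hc with
      | refl =>
        exact ⟨0, Nat.zero_le _, by simp [initConf, rootPos_eq], List.nodup_nil, RD_refl⟩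
      | tail _ hs ih =>
        rename_i b c _
        obtain ⟨q, hs1, π⟩ := b
        obtain ⟨q', hs2, π'⟩ := c
        obtain ⟨v, hv, rfl, hn, hI⟩ := ih
        exact Inv_step hv hn hI hs
    obtain ⟨v, hv, h1, -, h2⟩ := key _ h
    simp only [rootPos_eq] at h1
    rw [fun1_inj, toPos_inj w (Nat.zero_le _) hv] at h1
    subst h1
    exact h2
  · intro h
    have := RD_sound (w := w) _ [] _ _ List.nodup_nil h
    simp only [initConf, rootPos_eq]
    exact this

theorem halting_iff (w : List Sig) (q : A.Q) :
    HaltingConf A (encodeString w) (q, (fun _ => rootPos _), []) ↔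
    ¬ ∃ e ∈ A.instr, e.1 = q ∧ ((∃ v ≤ w.length, smp w (fun _ => none) e.2.1 0 v) ∨
      ∃ i x, e.2.1 = .dropPeb i x) := by
  unfold HaltingConf
  rw [← not_exists]
  refine not_congr ?_
  constructor
  · rintro ⟨⟨q', hs', π'⟩, ins, hi, hst⟩
    refine ⟨_, hi, rfl, ?_⟩
    obtain ⟨v, hv, hv'⟩ := exists_toPos w (hs' 0)
    have hh := fun1_ext _ _ hv'
    subst hh
    simp only [rootPos_eq] at hst
    rcases instr_cases [] π' List.nodup_nil ins (Nat.zero_le _) hv hst with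
      ⟨rfl, h1⟩ | ⟨i, x, rfl, _⟩ | ⟨x, y, _, _, h⟩
    · exact .inl ⟨v, hv, h1⟩
    · exact .inr ⟨i, x, rfl⟩
    · cases h
  · rintro ⟨⟨_, ins, q'⟩, hi, rfl, ⟨v, hv, h⟩ | ⟨i, x, h⟩⟩
    · refine ⟨(q', (fun _ => toPos w v), []), ins, hi, ?_⟩
      simp only [rootPos_eq]
      exact instr_smp [] List.nodup_nil ins (Nat.zero_le _) hv h
    · cases h
      exact ⟨(q', (fun _ => rootPos _), [(x, rootPos _)]), _, hi, rfl, rfl, by simp⟩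

theorem nptwa_regular (L : Set (List Sig))
    (h : encodeString '' L ∈ NPTWA (Sig ⊕ Unit) (srank Sig) 1) :
    Language.IsRegular (L : Language Sig) := by
  obtain ⟨A, hL⟩ := h
  have := A.finQ
  have := A.finX
  let V := Option Empty
  let m : A.X → Option V := fun _ => none
  have hhalt : ∀ q : A.Q, DefP fun (w : List Sig) (p : V → ℕ) (_ : Empty → ℕ → Prop) =>
      ∃ e ∈ A.instr, e.1 = q ∧
        ((∃ v ≤ w.length, smp w (fun x => ((m x).map some).map (ext1 p v)) e.2.1
          (ext1 p v (some none)) (ext1 p v none)) ∨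
      ∃ i x, e.2.1 = .dropPeb i x) := fun q =>
    DefP.exFin A.instrFin fun e _ => (DefP.const _).and
      (((smp_def e.2.1 _ _ _).ex).or (DefP.const _))
  have h1 : DefP fun (w : List Sig) (p : V → ℕ) (_ : Empty → ℕ → Prop) => p none = 0 ∧
      ∃ q : A.Q, q ∈ A.acc ∧
        RD A w (Fintype.card A.X) (fun x => (m x).map p) (A.q0, p none) (q, p none) ∧ _ :=
    (DefP.isZero none).and (DefP.exFinite fun q => (DefP.const _).and
      ((RD_def A _ _ _ _ _ _ _ _).and (hhalt q).not))
  have h3 : DefP fun (w : List Sig) (_ : Empty → ℕ) (_ : Empty → ℕ → Prop) => w ∈ L := by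
    refine h1.ex.congr fun w p X hp => ?_
    rw [← encode_injective.mem_set_image, hL]
    have hA : encodeString w ∈ Lang A ↔ ∃ q ∈ A.acc,
      RD A w (Fintype.card A.X) (fun _ => none) (A.q0, 0) (q, 0) ∧
      ¬ ∃ e ∈ A.instr, e.1 = q ∧ ((∃ v ≤ w.length, smp w (fun _ => none) e.2.1 0 v) ∨
      ∃ i x, e.2.1 = .dropPeb i x) := by
      refine exists_congr fun q => and_congr_right fun _ => ?_
      rw [reach_iff, halting_iff]
    rw [hA]
    constructor
    · rintro ⟨q, hq⟩
      exact ⟨0, Nat.zero_le _, rfl, q, hq⟩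
    · rintro ⟨i, -, h0, q, hq⟩
      have h0 : i = 0 := h0
      subst h0
      exact ⟨q, hq⟩
  exact h3.isRegular

end Pebbles
end NestedPebbles

namespace NestedPebbles

section RegToTWA
variable {Sig : Type}

/-- The two-way automaton simulating a finite automaton. -/
def dfaTWA [Fintype Sig] {σ : Type} [Fintype σ] (M : DFA Sig σ) : TWA (Sig ⊕ Unit) (srank Sig) 1 where
  Q := σ ⊕ (σ × Sig) ⊕ Bool
  finQ := inferInstance
  X := Empty
  finX := inferInstance
  q0 := .inl M.start
  acc := {.inr (.inr true)}
  instr := Set.range (fun e : σ × Sig => (.inl e.1, .test true (.lab 0 (.inl e.2)), .inr (.inl e))) ∪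
    Set.range (fun e : σ × Sig => (.inr (.inl e), .down 0 1, .inl (M.step e.1 e.2))) ∪
    (fun s => (.inl s, .test true (.lab 0 (.inr ())), .inr (.inr false))) '' M.accept ∪
    {(.inr (.inr false), .up 0, .inr (.inr false)),
     (.inr (.inr false), .test true (.chno 0 0), .inr (.inr true))}
  instrFin := (((Set.finite_range _).union (Set.finite_range _)).union
    ((Set.toFinite _).image _)).union (Set.toFinite _)

/-- Invariant of the simulation. -/
def dinv {σ : Type} (M : DFA Sig σ) (w : List Sig) : σ ⊕ (σ × Sig) ⊕ Bool → ℕ → Prop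
  | .inl s, i => M.eval (w.take i) = s
  | .inr (.inl (s, a)), i => M.eval (w.take i) = s ∧ w[i]? = some a
  | .inr (.inr _), _ => w ∈ M.accepts

theorem eval_take_succ {σ : Type} (M : DFA Sig σ) (w : List Sig) {i : ℕ} {a : Sig}
    (h : w[i]? = some a) : M.eval (w.take (i + 1)) = M.step (M.eval (w.take i)) a := by
  rw [List.take_add_one, h]
  exact DFA.eval_append_singleton _ _ _

theorem dfaTWA_accepts [Fintype Sig] {σ : Type} [Fintype σ] (M : DFA Sig σ) (w : List Sig) :
    Accepts (dfaTWA M) (encodeString w) ↔ w ∈ M.accepts := by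
  constructor
  · rintro ⟨q, hq, hr, -⟩
    have key : ∀ c, Relation.ReflTransGen (Step (dfaTWA M) (encodeString w))
        (initConf (dfaTWA M) (encodeString w)) c →
        ∃ v ≤ w.length, (c.2.1 = fun _ => toPos w v) ∧ c.2.2 = [] ∧ dinv M w c.1 v := by
      intro c hc
      induction hc with
      | refl =>
        exact ⟨0, Nat.zero_le _, by simp [initConf, rootPos_eq], rfl, rfl⟩
      | tail _ hs ih =>
        rename_i b c _
        obtain ⟨q, hs1, π⟩ := b
        obtain ⟨q', hs2, π'⟩ := c
        obtain ⟨u, hu, rfl, hπ, hI⟩ := ih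
        obtain ⟨v, hv, hv'⟩ := exists_toPos w (hs2 0)
        have hh := fun1_ext _ _ hv'
        subst hh
        refine ⟨v, hv, rfl, ?_⟩
        have hnil : ∀ l : List ((dfaTWA M).X × Pos (encodeString w)), l = [] := by
          intro l
          cases l with
          | nil => rfl
          | cons e l => exact e.1.elim
        refine ⟨hnil _, ?_⟩
        have hπ : π = [] := hπ
        subst hπ
        obtain ⟨ins, hi, hst⟩ := hs
        rcases instr_cases [] π' List.nodup_nil ins hu hv hst with ⟨-, h1⟩ | ⟨i, x, -⟩ | ⟨x, -⟩
        · simp only [dfaTWA] at hi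
          rcases hi with ((⟨⟨s, a⟩, he⟩ | ⟨⟨s, a⟩, he⟩) | ⟨s, hsa, he⟩) | he | he
          · cases he
            obtain ⟨rfl, h2⟩ := h1
            have h2 : labelAt (encodeString w) (toPos w v).1 = some (Sum.inl a) := h2.2 rfl
            exact ⟨hI, (label_inl_iff w hu a).1 h2⟩
          · cases he
            obtain ⟨-, rfl⟩ := h1
            obtain ⟨rfl, ha⟩ := hI
            exact eval_take_succ M w ha
          · cases he
            obtain ⟨rfl, h2⟩ := h1
            have h2 : labelAt (encodeString w) (toPos w v).1 = some (Sum.inr ()) := h2.2 rfl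
            have h3 := (label_inr_iff w hu ()).1 h2
            rw [List.getElem?_eq_none_iff] at h3
            have hI : M.eval (w.take v) = s := hI
            rw [List.take_of_length_le h3] at hI
            subst hI
            exact hsa
          · cases he
            exact hI
          · cases he
            exact hI
        · exact x.elim
        · exact x.elim
    obtain ⟨v, -, -, -, h⟩ := key _ hr
    have hq : q = .inr (.inr true) := hq
    subst hq
    exact h
  · intro hw
    have hrun : ∀ i ≤ w.length, Relation.ReflTransGen (Step (dfaTWA M) (encodeString w))
        (initConf (dfaTWA M) (encodeString w)) (.inl (M.eval (w.take i)), (fun _ => toPos w i), []) := by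
      intro i hi
      induction i with
      | zero =>
        simp only [initConf, rootPos_eq]
        exact .refl
      | succ i ih =>
        have hlt : i < w.length := hi
        have ha := List.getElem?_eq_getElem hlt
        rw [eval_take_succ M w ha]
        refine ((ih hlt.le).tail (b := (_ : TConf (dfaTWA M) (encodeString w)))
          (c := (.inr (.inl (M.eval (w.take i), w[i])), (fun _ => toPos w i), [])) ?_).tail ?_
        · refine ⟨.test true (.lab 0 (.inl w[i])), .inl (.inl (.inl ⟨(_, _), rfl⟩)), ?_⟩
          refine instr_smp [] List.nodup_nil _ hlt.le hlt.le ⟨rfl, ?_⟩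
          simp only [smpTest, iff_true]
          exact (label_inl_iff w hlt.le _).2 ha
        · refine ⟨.down 0 1, .inl (.inl (.inr ⟨(_, _), rfl⟩)), ?_⟩
          exact instr_smp [] List.nodup_nil _ hlt.le hi ⟨rfl, rfl⟩
    have hup : ∀ i ≤ w.length, Relation.ReflTransGen (Step (dfaTWA M) (encodeString w))
        (.inr (.inr false), (fun _ => toPos w i), []) (.inr (.inr false), (fun _ => toPos w 0), []) := by
      intro i hi
      induction i with
      | zero => exact .refl
      | succ i ih =>
        refine Relation.ReflTransGen.head ?_ (ih (by omega))
        refine ⟨.up 0, .inr (.inl rfl), ?_⟩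
        exact instr_smp [] List.nodup_nil _ hi (by omega) rfl
    refine ⟨.inr (.inr true), rfl, ?_, ?_⟩
    · have h1 := hrun w.length le_rfl
      rw [List.take_length] at h1
      simp only [rootPos_eq]
      refine ((h1.tail (c := (.inr (.inr false), (fun _ => toPos w w.length), [])) ?_).trans
        (hup _ le_rfl)).tail ?_
      · refine ⟨.test true (.lab 0 (.inr ())), .inl (.inr ⟨_, hw, rfl⟩), ?_⟩
        refine instr_smp [] List.nodup_nil _ le_rfl le_rfl ⟨rfl, ?_⟩
        simp only [smpTest, iff_true]
        exact (label_inr_iff w le_rfl ()).2 (by simp)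
      · refine ⟨.test true (.chno 0 0), .inr (.inr rfl), ?_⟩
        refine instr_smp [] List.nodup_nil _ (Nat.zero_le _) (Nat.zero_le _) ⟨rfl, ?_⟩
        simp [smpTest]
    · rintro ⟨q', hs', π'⟩ ⟨ins, hi, -⟩
      rcases hi with ((⟨e, he⟩ | ⟨e, he⟩) | ⟨s, hsa, he⟩) | he | he <;> cases he

theorem regular_nptwa [Fintype Sig] (L : Set (List Sig)) (h : Language.IsRegular (L : Language Sig)) :
    encodeString '' L ∈ NPTWA (Sig ⊕ Unit) (srank Sig) 1 := by
  obtain ⟨σ, _, M, rfl⟩ := h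
  refine ⟨dfaTWA M, ?_⟩
  ext t
  obtain ⟨w, rfl⟩ := encode_surjective t
  refine (encode_injective.mem_set_image (s := (M.accepts : Set (List Sig)))).trans ?_
  exact (dfaTWA_accepts M w).symm

end RegToTWA

section RegToFO

theorem rtg_lift {α β : Type} {r : α → α → Prop} {p : β → β → Prop} {a b : α} (f : α → β)
    (h : ∀ a b, r a b → p (f a) (f b)) (hab : Relation.ReflTransGen r a b) :
    Relation.ReflTransGen p (f a) (f b) := by
  induction hab with
  | refl => exact .refl
  | tail _ h2 ih => exact ih.tail (h _ _ h2)

/-- Nonempty paths with intermediate nodes in `S`. -/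
inductive Pth {C : Type} (r : C → C → Prop) (S : Set C) : C → C → Prop
  | one {c d : C} : r c d → Pth r S c d
  | cons {c e d : C} : r c e → e ∈ S → Pth r S e d → Pth r S c d

theorem Pth.mono {C : Type} {r : C → C → Prop} {S T : Set C} (hST : S ⊆ T) {c d : C}
    (h : Pth r S c d) : Pth r T c d := by
  induction h with
  | one h => exact .one h
  | cons h he _ ih => exact .cons h (hST he) ih

theorem Pth.trans {C : Type} {r : C → C → Prop} {S : Set C} {c e d : C}
    (h : Pth r S c e) (he : e ∈ S) (h' : Pth r S e d) : Pth r S c d := by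
  induction h with
  | one h => exact .cons h he h'
  | cons h he' _ ih => exact .cons h he' (ih he h')

theorem Pth.kleene {C : Type} (r : C → C → Prop) (S T : Set C) (c d : C) :
    Pth r (S ∪ T) c d ↔ Pth r S c d ∨ ∃ z y, z ∈ T ∧ y ∈ T ∧ Pth r S c z ∧
      Relation.ReflTransGen (fun a b => a ∈ T ∧ b ∈ T ∧ Pth r S a b) z y ∧ Pth r S y d := by
  constructor
  · intro h
    induction h with
    | one h => exact .inl (.one h)
    | cons h he _ ih =>
      rename_i c e d _
      rcases he with he | he
      · rcases ih with ih | ⟨z, y, hz, hy, h1, h2, h3⟩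
        · exact .inl (.cons h he ih)
        · exact .inr ⟨z, y, hz, hy, .cons h he h1, h2, h3⟩
      · rcases ih with ih | ⟨z, y, hz, hy, h1, h2, h3⟩
        · exact .inr ⟨e, e, he, he, .one h, .refl, ih⟩
        · exact .inr ⟨e, y, he, hy, .one h, .head ⟨he, hz, h1⟩ h2, h3⟩
  · rintro (h | ⟨z, y, hz, hy, h1, h2, h3⟩)
    · exact h.mono Set.subset_union_left
    · have hS : S ⊆ S ∪ T := Set.subset_union_left
      have h4 : Pth r (S ∪ T) c y := by
        clear h3 hy
        induction h2 with
        | refl => exact h1.mono hS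
        | tail _ h ih => exact ih.trans (.inr h.1) (h.2.2.mono hS)
      exact h4.trans (.inr hy) (h3.mono hS)

theorem Pth.det {C : Type} {r : C → C → Prop} (hr : ∀ a b b', r a b → r a b' → b = b')
    {S T : Set C} (hST : ∀ a, a ∈ S → a ∉ T) {a b b' : C} (hb : b ∈ T) (hb' : b' ∈ T)
    (h : Pth r S a b) (h' : Pth r S a b') : b = b' := by
  induction h with
  | one h =>
    cases h' with
    | one h' => exact hr _ _ _ h h'
    | cons h' he _ =>
      cases hr _ _ _ h h'
      exact absurd hb (hST _ he)
  | cons h he _ ih =>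
    cases h' with
    | one h' =>
      cases hr _ _ _ h h'
      exact absurd hb' (hST _ he)
    | cons h' he' h2 =>
      cases hr _ _ _ h h'
      exact ih hb h2

theorem rtg_iff_pth {C : Type} (r : C → C → Prop) (a b : C) :
    Relation.ReflTransGen r a b ↔ a = b ∨ Pth r Set.univ a b := by
  constructor
  · intro h
    induction h with
    | refl => exact .inl rfl
    | tail _ h ih =>
      rcases ih with rfl | ih
      · exact .inr (.one h)
      · exact .inr (ih.trans trivial (.one h))
  · rintro (rfl | h)
    · exact .refl
    · induction h with
      | one h => exact .single h
      | cons h _ _ ih => exact .head h ih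

variable {Sig : Type}

/-- Binary relations on tree nodes definable with deterministic unary transitive closure. -/
def FDef (R : ∀ t : RTree (Sig ⊕ Unit) (srank Sig), Pos t → Pos t → Prop) : Prop :=
  ∀ x y : ℕ, x ≠ y → ∃ φ : TForm (Sig ⊕ Unit) (srank Sig) 1, WF φ ∧ DetTC φ ∧
    freeVars φ ⊆ {x, y} ∧ ∀ t ν, Sat t φ ν ↔ R t (ν x) (ν y)

variable {R R' : ∀ t : RTree (Sig ⊕ Unit) (srank Sig), Pos t → Pos t → Prop}

theorem FDef.congr (h : FDef R) (hR : ∀ t u v, R' t u v ↔ R t u v) : FDef R' := by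
  intro x y hxy
  obtain ⟨φ, h1, h2, h3, h4⟩ := h x y hxy
  exact ⟨φ, h1, h2, h3, fun t ν => (h4 t ν).trans (hR _ _ _).symm⟩

theorem FDef.or (h : FDef R) (h' : FDef R') : FDef fun t u v => R t u v ∨ R' t u v := by
  intro x y hxy
  obtain ⟨φ, h1, h2, h3, h4⟩ := h x y hxy
  obtain ⟨φ', h1', h2', h3', h4'⟩ := h' x y hxy
  exact ⟨.or φ φ', ⟨h1, h1'⟩, ⟨h2, h2'⟩, Set.union_subset h3 h3',
    fun t ν => or_congr (h4 t ν) (h4' t ν)⟩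

theorem FDef.and (h : FDef R) (h' : FDef R') : FDef fun t u v => R t u v ∧ R' t u v := by
  intro x y hxy
  obtain ⟨φ, h1, h2, h3, h4⟩ := h x y hxy
  obtain ⟨φ', h1', h2', h3', h4'⟩ := h' x y hxy
  exact ⟨.and φ φ', ⟨h1, h1'⟩, ⟨h2, h2'⟩, Set.union_subset h3 h3',
    fun t ν => and_congr (h4 t ν) (h4' t ν)⟩

theorem FDef.const (c : Prop) :
    FDef fun (t : RTree (Sig ⊕ Unit) (srank Sig)) (_ _ : Pos t) => c := by
  intro x y hxy
  by_cases hc : c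
  · exact ⟨.eq x x, trivial, trivial, by simp [freeVars], fun t ν => by simp [Sat, hc]⟩
  · exact ⟨.not (.eq x x), trivial, trivial, by simp [freeVars], fun t ν => by simp [Sat, hc]⟩

theorem FDef.eq : FDef fun (t : RTree (Sig ⊕ Unit) (srank Sig)) (u v : Pos t) => u = v := by
  intro x y hxy
  exact ⟨.eq x y, trivial, trivial, by simp [freeVars], fun t ν => Iff.rfl⟩

theorem FDef.edge :
    FDef fun (t : RTree (Sig ⊕ Unit) (srank Sig)) (u v : Pos t) => v.1 = u.1 ++ [0] := by
  intro x y hxy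
  exact ⟨.edg 1 x y, trivial, trivial, by simp [freeVars], fun t ν => by simp [Sat]⟩

theorem FDef.lab1 (a : Sig ⊕ Unit) :
    FDef fun (t : RTree (Sig ⊕ Unit) (srank Sig)) (u _ : Pos t) => labelAt t u.1 = some a := by
  intro x y hxy
  exact ⟨.lab a x, trivial, trivial, by simp [freeVars], fun t ν => Iff.rfl⟩

theorem FDef.lab2 (a : Sig ⊕ Unit) :
    FDef fun (t : RTree (Sig ⊕ Unit) (srank Sig)) (_ v : Pos t) => labelAt t v.1 = some a := by
  intro x y hxy
  exact ⟨.lab a y, trivial, trivial, by simp [freeVars], fun t ν => Iff.rfl⟩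

theorem FDef.root :
    FDef fun (t : RTree (Sig ⊕ Unit) (srank Sig)) (u _ : Pos t) => u = rootPos t := by
  intro x y hxy
  refine ⟨.all y (.le x y), trivial, trivial, ?_, fun t ν => ?_⟩
  · rintro z ⟨h1, h2⟩
    simp only [freeVars, Set.mem_insert_iff, Set.mem_singleton_iff] at h1 h2 ⊢
    tauto
  · simp only [Sat, Function.update_self, Function.update_of_ne hxy]
    constructor
    · intro h
      have := h (rootPos t)
      exact Subtype.ext (List.prefix_nil.1 this)
    · intro h u
      rw [h]
      exact ⟨_, rfl⟩

theorem FDef.comp (h : FDef R) (h' : FDef R') : FDef fun t u v => ∃ z, R t u z ∧ R' t z v := by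
  intro x y hxy
  let z := x + y + 1
  have hxz : x ≠ z := by omega
  have hzy : z ≠ y := by omega
  obtain ⟨φ, h1, h2, h3, h4⟩ := h x z hxz
  obtain ⟨φ', h1', h2', h3', h4'⟩ := h' z y hzy
  refine ⟨.ex z (.and φ φ'), ⟨h1, h1'⟩, ⟨h2, h2'⟩, ?_, fun t ν => ?_⟩
  · rintro a ⟨ha | ha, hz⟩
    · have := h3 ha
      simp only [Set.mem_insert_iff, Set.mem_singleton_iff] at this hz ⊢
      tauto
    · have := h3' ha
      simp only [Set.mem_insert_iff, Set.mem_singleton_iff] at this hz ⊢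
      tauto
  · simp only [Sat, h4, h4', Function.update_self, Function.update_of_ne hxz,
      Function.update_of_ne hzy.symm]

theorem FDef.star (h : FDef R) (hf : ∀ t u v v', R t u v → R t u v' → v = v') :
    FDef fun t u v => Relation.ReflTransGen (R t) u v := by
  intro x y hxy
  obtain ⟨φ, h1, h2, h3, h4⟩ := h x y hxy
  have hsat : ∀ t (ν : ℕ → Pos t) a b,
      Sat t (.and φ (.and (.eq x x) (.eq y y))) (updVec (updVec ν (fun _ : Fin 1 => x) a) (fun _ : Fin 1 => y) b)
      ↔ R t (a 0) (b 0) := by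
    intro t ν a b
    simp only [Sat, h4, updVec_one, Function.update_self, Function.update_of_ne hxy, and_true]
  refine ⟨.tc (fun _ => x) (fun _ => y) (.and φ (.and (.eq x x) (.eq y y))) (fun _ => x) (fun _ => y),
    ⟨⟨Function.injective_of_subsingleton _, Function.injective_of_subsingleton _, fun _ _ => hxy⟩,
      ?_, h1, trivial, trivial⟩, ⟨?_, h2, trivial, trivial⟩, ?_, fun t ν => ?_⟩
  · rintro z (⟨_, rfl⟩ | ⟨_, rfl⟩) <;> simp [freeVars]
  · intro t ν a b b' hb hb'
    rw [hsat] at hb hb'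
    funext i
    rw [Subsingleton.elim i 0]
    exact hf _ _ _ _ hb hb'
  · rintro z ((⟨hz, hz'⟩ | ⟨_, rfl⟩) | ⟨_, rfl⟩)
    · exfalso
      have hz0 : z ∈ ({x, y} : Set ℕ) := by
        rcases hz with hz | hz | hz
        · exact h3 hz
        · simp only [freeVars, Set.mem_insert_iff, Set.mem_singleton_iff, or_self] at hz; simp [hz]
        · simp only [freeVars, Set.mem_insert_iff, Set.mem_singleton_iff, or_self] at hz; simp [hz]
      apply hz'
      rcases hz0 with rfl | hz0
      · exact .inl ⟨0, rfl⟩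
      · exact .inr ⟨0, (Set.mem_singleton_iff.1 hz0).symm⟩
    · simp
    · simp
  · rw [Sat]
    simp only [hsat]
    constructor
    · intro h
      exact rtg_lift (fun a : Fin 1 → Pos t => a 0) (fun a b h => h) h
    · intro h
      exact rtg_lift (fun a (_ : Fin 1) => a) (fun a b h => h) h

theorem FDef.exFinset {I : Type} (s : Finset I)
    {Q : I → ∀ t : RTree (Sig ⊕ Unit) (srank Sig), Pos t → Pos t → Prop}
    (h : ∀ i, FDef (Q i)) : FDef fun t u v => ∃ i ∈ s, Q i t u v := by
  classical
  induction s using Finset.induction_on with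
  | empty => exact (FDef.const False).congr fun t u v => by simp
  | insert a s _ ih => exact ((h a).or ih).congr fun t u v => by simp

variable {σ : Type} (M : DFA Sig σ)

/-- One step of the automaton on the tree. -/
def stp (t : RTree (Sig ⊕ Unit) (srank Sig)) (c d : σ × Pos t) : Prop :=
  ∃ a, labelAt t c.2.1 = some (Sum.inl a) ∧ d.1 = M.step c.1 a ∧ d.2.1 = c.2.1 ++ [0]

theorem stp_det (t : RTree (Sig ⊕ Unit) (srank Sig)) (a b b' : σ × Pos t)
    (h : stp M t a b) (h' : stp M t a b') : b = b' := by
  obtain ⟨x, h1, h2, h3⟩ := h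
  obtain ⟨x', h1', h2', h3'⟩ := h'
  rw [h1] at h1'
  cases h1'
  exact Prod.ext (h2.trans h2'.symm) (Subtype.ext (h3.trans h3'.symm))

theorem pth_def [Fintype Sig] (S : Finset σ) : ∀ p q : σ,
    FDef fun t u v => Pth (stp M t) {c | c.1 ∈ S} (p, u) (q, v) := by
  classical
  induction S using Finset.induction_on with
  | empty =>
    intro p q
    have h : FDef fun (t : RTree (Sig ⊕ Unit) (srank Sig)) (u v : Pos t) =>
        ∃ a ∈ (Finset.univ : Finset Sig), q = M.step p a ∧
        (labelAt t u.1 = some (Sum.inl a) ∧ v.1 = u.1 ++ [0]) :=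
      FDef.exFinset _ fun a => (FDef.const _).and ((FDef.lab1 _).and FDef.edge)
    refine h.congr fun t u v => ?_
    constructor
    · intro h
      cases h with
      | one h =>
        obtain ⟨a, h1, h2, h3⟩ := h
        exact ⟨a, Finset.mem_univ _, h2, h1, h3⟩
      | cons _ he _ => exact absurd he (Finset.notMem_empty _)
    · rintro ⟨a, -, h2, h1, h3⟩
      exact .one ⟨a, h1, h2, h3⟩
  | insert s S hs ih =>
    intro p q
    have hdet : ∀ (t : RTree (Sig ⊕ Unit) (srank Sig)) (u v v' : Pos t),
        Pth (stp M t) {c | c.1 ∈ S} (s, u) (s, v) → Pth (stp M t) {c | c.1 ∈ S} (s, u) (s, v') →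
        v = v' := by
      intro t u v v' h h'
      have := Pth.det (stp_det M t) (T := {c | c.1 = s}) (fun a ha ha' => by
        have ha : a.1 ∈ S := ha
        have ha' : a.1 = s := ha'
        rw [ha'] at ha
        exact hs ha) rfl rfl h h'
      exact congrArg Prod.snd this
    have h := (ih p q).or ((ih p s).comp (((ih s s).star hdet).comp (ih s q)))
    refine h.congr fun t u v => ?_
    have hset : ({c | c.1 ∈ insert s S} : Set (σ × Pos t)) = {c | c.1 ∈ S} ∪ {c | c.1 = s} := by
      ext c
      simp [or_comm]
    rw [hset, Pth.kleene]
    refine or_congr_right ?_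
    constructor
    · rintro ⟨⟨_, z⟩, ⟨_, y⟩, rfl, hy, h1, h2, h3⟩
      have hy : _ = _ := hy
      dsimp only at hy
      subst hy
      refine ⟨z, h1, y, ?_, h3⟩
      refine rtg_lift (fun c : σ × Pos t => c.2) ?_ h2
      rintro ⟨a1, a2⟩ ⟨b1, b2⟩ ⟨ha, hb, hab⟩
      have ha : a1 = _ := ha
      have hb : b1 = _ := hb
      subst ha
      subst hb
      exact hab
    · rintro ⟨z, h1, y, h2, h3⟩
      refine ⟨(s, z), (s, y), rfl, rfl, h1, ?_, h3⟩
      exact rtg_lift (fun a => (s, a)) (fun a b h => ⟨rfl, rfl, h⟩) h2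

theorem stp_reach (w : List Sig) {q : σ} {u v : Pos (encodeString w)} (hu : u = rootPos _)
    (hv : labelAt (encodeString w) v.1 = some (Sum.inr ())) :
    Relation.ReflTransGen (stp M (encodeString w)) (M.start, u) (q, v) → q = M.eval w := by
  intro h
  have key : ∀ c, Relation.ReflTransGen (stp M (encodeString w)) (M.start, u) c →
      ∃ i ≤ w.length, c = (M.eval (w.take i), toPos w i) := by
    intro c hc
    induction hc with
    | refl => exact ⟨0, Nat.zero_le _, by rw [hu, rootPos_eq]; rfl⟩
    | tail _ hs ih =>
      obtain ⟨i, hi, rfl⟩ := ih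
      obtain ⟨a, h1, h2, h3⟩ := hs
      rename_i c _
      obtain ⟨q, v⟩ := c
      obtain ⟨j, hj, rfl⟩ := exists_toPos w v
      obtain ⟨-, rfl⟩ := (edge_iff w hi hj 0).1 h3
      refine ⟨i + 1, hj, ?_⟩
      rw [eval_take_succ M w ((label_inl_iff w hi a).1 h1)]
      exact Prod.ext h2 rfl
  obtain ⟨i, hi, he⟩ := key _ h
  cases he
  have h3 := (label_inr_iff w hi ()).1 hv
  rw [List.getElem?_eq_none_iff] at h3
  rw [List.take_of_length_le h3]

theorem stp_reach' (w : List Sig) :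
    Relation.ReflTransGen (stp M (encodeString w)) (M.start, toPos w 0)
      (M.eval w, toPos w w.length) := by
  have hrun : ∀ i ≤ w.length, Relation.ReflTransGen (stp M (encodeString w)) (M.start, toPos w 0)
      (M.eval (w.take i), toPos w i) := by
    intro i hi
    induction i with
    | zero => exact .refl
    | succ i ih =>
      have hlt : i < w.length := hi
      have ha := List.getElem?_eq_getElem hlt
      rw [eval_take_succ M w ha]
      exact (ih hlt.le).tail ⟨w[i], (label_inl_iff w hlt.le _).2 ha, rfl,
        (edge_iff w hlt.le hi 0).2 ⟨rfl, rfl⟩⟩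
  simpa using hrun w.length le_rfl

theorem regular_fodtc [Fintype Sig] (L : Set (List Sig))
    (h : Language.IsRegular (L : Language Sig)) :
    encodeString '' L ∈ FODTC (Sig ⊕ Unit) (srank Sig) 1 := by
  classical
  obtain ⟨σ, _, M, rfl⟩ := h
  have hd : FDef fun (t : RTree (Sig ⊕ Unit) (srank Sig)) (u v : Pos t) =>
      (u = rootPos t ∧ labelAt t v.1 = some (Sum.inr ())) ∧
      ∃ q ∈ (Finset.univ : Finset σ), q ∈ M.accept ∧
        ((M.start = q ∧ u = v) ∨ Pth (stp M t) {c | c.1 ∈ (Finset.univ : Finset σ)} (M.start, u) (q, v)) :=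
    (FDef.root.and (FDef.lab2 _)).and (FDef.exFinset _ fun q => (FDef.const _).and
      (((FDef.const _).and FDef.eq).or (pth_def M _ _ _)))
  obtain ⟨φ, h1, h2, h3, h4⟩ := hd 0 1 (by decide)
  refine ⟨.ex 0 (.ex 1 φ), h1, h2, ?_, ?_⟩
  · rw [Set.eq_empty_iff_forall_notMem]
    rintro z ⟨⟨hz, hz1⟩, hz0⟩
    rcases h3 hz with h | h
    · exact hz0 h
    · exact hz1 h
  · ext t
    obtain ⟨w, rfl⟩ := encode_surjective t
    refine (encode_injective.mem_set_image (s := (M.accepts : Set (List Sig)))).trans ?_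
    have hT : encodeString w ∈ treesOf (TForm.ex 0 (.ex 1 φ)) ↔
        ∃ u v : Pos (encodeString w), (u = rootPos _ ∧ labelAt (encodeString w) v.1 = some (Sum.inr ())) ∧
        ∃ q, q ∈ M.accept ∧ Relation.ReflTransGen (stp M (encodeString w)) (M.start, u) (q, v) := by
      show Sat _ _ _ ↔ _
      simp only [Sat, h4, rtg_iff_pth, Finset.mem_univ, true_and, Prod.mk.injEq, Function.update_self]
      rfl
    rw [hT]
    constructor
    · intro hw
      refine ⟨_, toPos w w.length, ⟨rfl, (label_inr_iff w le_rfl ()).2 (by simp)⟩, M.eval w, hw, ?_⟩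
      rw [rootPos_eq]
      exact stp_reach' M w
    · rintro ⟨u, v, ⟨hu, hv⟩, q, hq, hr⟩
      rw [stp_reach M w hu hv hr] at hq
      exact hq

end RegToFO
end NestedPebbles


namespace NestedPebbles

/-- For string languages, viewed as languages of monadic trees,
`REG = NPTWA^1 = FO+DTC^1`: a language is regular iff its encoding is accepted by
a nondeterministic single-head two-way automaton with nested pebbles, iff its
encoding is definable in first-order logic with unary deterministic transitive
closure. -/
theorem REG_eq_NPTWA1_eq_FODTC1 (Sig : Type) [Fintype Sig] (L : Set (List Sig)) :
    (Language.IsRegular (L : Language Sig) ↔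
      encodeString '' L ∈ NPTWA (Sig ⊕ Unit) (srank Sig) 1) ∧
    (Language.IsRegular (L : Language Sig) ↔
      encodeString '' L ∈ FODTC (Sig ⊕ Unit) (srank Sig) 1) := by
  exact ⟨⟨regular_nptwa L, nptwa_regular L⟩, ⟨regular_fodtc L, fodtc_regular L⟩⟩

end NestedPebbles
end

section
/- For every family of graphs over an alphabet Σ and every k ≥ 1, every graph language accepted by a deterministic k-head graph-walking automaton with nested pebbles is definable in first-order logic with k-ary deterministic transitive closure: DPTWA^k ⊆ FO+DTC^k. -/
namespace NestedPebblesGraphs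

/-- A nonempty finite weakly connected directed graph with node and edge labels
from `Sig`, such that no node has two outgoing edges with the same label, nor two
incoming edges with the same label. -/
structure LGraph (Sig : Type) : Type 1 where
  V : Type
  finV : Fintype V
  neV : Nonempty V
  nlab : V → Sig
  edge : Sig → V → V → Prop
  out_unique : ∀ a u v v', edge a u v → edge a u v' → v = v'
  in_unique : ∀ a u u' v, edge a u v → edge a u' v → u = u'
  conn : ∀ u v : V,
    Relation.ReflTransGen (fun x y => (∃ a, edge a x y) ∨ (∃ a, edge a y x)) u v

variable {Sig : Type}

/-!  ### First-order logic with k-ary transitive closure, on graphs  -/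

/-- First-order formulas on graphs over `Sig`, with a `k`-ary transitive closure
operator.  `lab a x` means node `x` has label `a`; `edg a x y` means there is an
`a`-labelled edge from `x` to `y`; `tc xs ys φ us vs` is the transitive closure
`φ*` of `φ` with respect to the tuples of variables `xs`, `ys` (which it binds),
applied to the tuples of variables `us`, `vs`. -/
inductive GForm (Sig : Type) (k : ℕ) : Type
  | lab (a : Sig) (x : ℕ)
  | edg (a : Sig) (x y : ℕ)
  | eq (x y : ℕ)
  | not (φ : GForm Sig k)
  | and (φ ψ : GForm Sig k)
  | or (φ ψ : GForm Sig k)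
  | ex (x : ℕ) (φ : GForm Sig k)
  | all (x : ℕ) (φ : GForm Sig k)
  | tc (xs ys : Fin k → ℕ) (φ : GForm Sig k) (us vs : Fin k → ℕ)

/-- Update a valuation on a tuple of variables simultaneously. -/
noncomputable def updVec {α : Type} {k : ℕ} (ν : ℕ → α) (xs : Fin k → ℕ) (a : Fin k → α) :
    ℕ → α :=
  fun n => if h : ∃ i, xs i = n then a h.choose else ν n

/-- Satisfaction of a formula in a graph `g` under a valuation of the variables. -/
def GSat {k : ℕ} (g : LGraph Sig) : GForm Sig k → (ℕ → g.V) → Prop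
  | .lab a x, ν => g.nlab (ν x) = a
  | .edg a x y, ν => g.edge a (ν x) (ν y)
  | .eq x y, ν => ν x = ν y
  | .not φ, ν => ¬ GSat g φ ν
  | .and φ ψ, ν => GSat g φ ν ∧ GSat g ψ ν
  | .or φ ψ, ν => GSat g φ ν ∨ GSat g ψ ν
  | .ex x φ, ν => ∃ u : g.V, GSat g φ (Function.update ν x u)
  | .all x φ, ν => ∀ u : g.V, GSat g φ (Function.update ν x u)
  | .tc xs ys φ us vs, ν =>
      Relation.ReflTransGen
        (fun a b : Fin k → g.V => GSat g φ (updVec (updVec ν xs a) ys b))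
        (fun i => ν (us i)) (fun i => ν (vs i))

/-- The free variables of a formula. -/
def gfree {k : ℕ} : GForm Sig k → Set ℕ
  | .lab _ x => {x}
  | .edg _ x y => {x, y}
  | .eq x y => {x, y}
  | .not φ => gfree φ
  | .and φ ψ => gfree φ ∪ gfree ψ
  | .or φ ψ => gfree φ ∪ gfree ψ
  | .ex x φ => gfree φ \ {x}
  | .all x φ => gfree φ \ {x}
  | .tc xs ys φ us vs =>
      (gfree φ \ (Set.range xs ∪ Set.range ys)) ∪ Set.range us ∪ Set.range vs

/-- Two `k`-tuples of variables consist of `2k` pairwise distinct variables. -/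
def Distinct2 {k : ℕ} (xs ys : Fin k → ℕ) : Prop :=
  Function.Injective xs ∧ Function.Injective ys ∧ ∀ i j, xs i ≠ ys j

/-- `φ` is functional in the tuples of variables `xs`, `ys`. -/
def GFunctionalIn {k : ℕ} (φ : GForm Sig k) (xs ys : Fin k → ℕ) : Prop :=
  ∀ (g : LGraph Sig) (ν : ℕ → g.V) (a b b' : Fin k → g.V),
    GSat g φ (updVec (updVec ν xs a) ys b) →
    GSat g φ (updVec (updVec ν xs a) ys b') → b = b'

/-- Well-formedness: in each transitive closure the `2k` bound variables are
pairwise distinct and occur free in the body. -/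
def GWF {k : ℕ} : GForm Sig k → Prop
  | .not φ => GWF φ
  | .and φ ψ => GWF φ ∧ GWF ψ
  | .or φ ψ => GWF φ ∧ GWF ψ
  | .ex _ φ => GWF φ
  | .all _ φ => GWF φ
  | .tc xs ys φ _ _ =>
      Distinct2 xs ys ∧ (Set.range xs ∪ Set.range ys) ⊆ gfree φ ∧ GWF φ
  | _ => True

/-- All transitive closures occurring in the formula are deterministic. -/
def GDetTC {k : ℕ} : GForm Sig k → Prop
  | .not φ => GDetTC φ
  | .and φ ψ => GDetTC φ ∧ GDetTC ψ
  | .or φ ψ => GDetTC φ ∧ GDetTC ψ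
  | .ex _ φ => GDetTC φ
  | .all _ φ => GDetTC φ
  | .tc xs ys φ _ _ => GFunctionalIn φ xs ys ∧ GDetTC φ
  | _ => True

/-- All occurrences of transitive closure are positive. -/
def GPosTC {k : ℕ} : Bool → GForm Sig k → Prop
  | b, .not φ => GPosTC (!b) φ
  | b, .and φ ψ => GPosTC b φ ∧ GPosTC b ψ
  | b, .or φ ψ => GPosTC b φ ∧ GPosTC b ψ
  | b, .ex _ φ => GPosTC b φ
  | b, .all _ φ => GPosTC b φ
  | b, .tc _ _ φ _ _ => b = true ∧ GPosTC b φ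
  | _, _ => True

/-- The formula contains no transitive closure operator (pure first-order). -/
def GTCFree {k : ℕ} : GForm Sig k → Prop
  | .not φ => GTCFree φ
  | .and φ ψ => GTCFree φ ∧ GTCFree ψ
  | .or φ ψ => GTCFree φ ∧ GTCFree ψ
  | .ex _ φ => GTCFree φ
  | .all _ φ => GTCFree φ
  | .tc _ _ _ _ _ => False
  | _ => True

/-- `FO+DTC^k` graph languages within the family `F`: those defined by closed
formulas with deterministic `k`-ary transitive closure. -/
def FODTCg (Sig : Type) (F : Set (LGraph Sig)) (k : ℕ) : Set (Set (LGraph Sig)) :=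
  {L | ∃ φ : GForm Sig k, GWF φ ∧ GDetTC φ ∧ gfree φ = ∅ ∧
        L = {g | g ∈ F ∧ ∀ ν : ℕ → g.V, GSat g φ ν}}

/-- `FO+posTC^k` graph languages within the family `F`. -/
def FOposTCg (Sig : Type) (F : Set (LGraph Sig)) (k : ℕ) : Set (Set (LGraph Sig)) :=
  {L | ∃ φ : GForm Sig k, GWF φ ∧ GPosTC true φ ∧ gfree φ = ∅ ∧
        L = {g | g ∈ F ∧ ∀ ν : ℕ → g.V, GSat g φ ν}}

/-!  ### k-head graph-walking automata with nested pebbles  -/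

/-- Tests of a `k`-head graph-walking automaton with pebble set `X`. -/
inductive GTest (Sig : Type) (k : ℕ) (X : Type) : Type
  | lab (i : Fin k) (a : Sig)
  | inedge (i : Fin k) (a : Sig)
  | outedge (i : Fin k) (a : Sig)
  | peb (i : Fin k) (x : X)

/-- Instructions: move head `i` along an incoming or outgoing `a`-labelled edge,
drop a pebble at head `i`, retrieve the most recently dropped pebble (from a
distance), jump head `i` to the node holding pebble `x`, or perform a positive
(`b = true`) or negated (`b = false`) test. -/
inductive GInstr (Sig : Type) (k : ℕ) (X : Type) : Type
  | inmove (i : Fin k) (a : Sig)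
  | outmove (i : Fin k) (a : Sig)
  | dropPeb (i : Fin k) (x : X)
  | retrieve (x : X)
  | jump (i : Fin k) (x : X)
  | test (b : Bool) (τ : GTest Sig k X)

/-- A `k`-head graph-walking automaton with nested pebbles. -/
structure GWA (Sig : Type) (k : ℕ) : Type 1 where
  Q : Type
  finQ : Fintype Q
  X : Type
  finX : Fintype X
  q0 : Q
  acc : Set Q
  instr : Set (Q × GInstr Sig k X × Q)
  instrFin : instr.Finite

/-- Configurations: a state, the positions of the `k` heads, and the stack of
dropped pebbles with their positions (most recent first). -/
abbrev GConf {k : ℕ} (A : GWA Sig k) (g : LGraph Sig) : Type :=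
  A.Q × (Fin k → g.V) × List (A.X × g.V)

/-- Semantics of tests. -/
def gTestHolds {k : ℕ} (g : LGraph Sig) {X : Type} (τ : GTest Sig k X)
    (hs : Fin k → g.V) (π : List (X × g.V)) : Prop :=
  match τ with
  | .lab i a => g.nlab (hs i) = a
  | .inedge i a => ∃ u, g.edge a u (hs i)
  | .outedge i a => ∃ v, g.edge a (hs i) v
  | .peb i x => (x, hs i) ∈ π

/-- Semantics of a single instruction. -/
def gInstrStep {k : ℕ} (g : LGraph Sig) {X : Type} (ins : GInstr Sig k X)
    (hs : Fin k → g.V) (π : List (X × g.V))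
    (hs' : Fin k → g.V) (π' : List (X × g.V)) : Prop :=
  match ins with
  | .inmove i a => π' = π ∧ g.edge a (hs' i) (hs i) ∧ ∀ h, h ≠ i → hs' h = hs h
  | .outmove i a => π' = π ∧ g.edge a (hs i) (hs' i) ∧ ∀ h, h ≠ i → hs' h = hs h
  | .dropPeb i x => hs' = hs ∧ π' = (x, hs i) :: π ∧ ∀ w, (x, w) ∉ π
  | .retrieve x => hs' = hs ∧ ∃ w, π = (x, w) :: π'
  | .jump i x => π' = π ∧ (x, hs' i) ∈ π ∧ ∀ h, h ≠ i → hs' h = hs h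
  | .test b τ => hs' = hs ∧ π' = π ∧ (gTestHolds g τ hs π ↔ b = true)

/-- The step relation of automaton `A` on graph `g`. -/
def GStep {k : ℕ} (A : GWA Sig k) (g : LGraph Sig) : GConf A g → GConf A g → Prop :=
  fun c c' => ∃ ins : GInstr Sig k A.X,
    (c.1, ins, c'.1) ∈ A.instr ∧ gInstrStep g ins c.2.1 c.2.2 c'.2.1 c'.2.2

/-- `χ'` is the negation of the test `χ`. -/
def gNegOf {k : ℕ} {X : Type} (χ χ' : GInstr Sig k X) : Prop :=
  ∃ b τ, χ = GInstr.test b τ ∧ χ' = GInstr.test (!b) τ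

/-- Determinism: any two distinct instructions with the same source state consist
of a test and its negation. -/
def GDeterministic {k : ℕ} (A : GWA Sig k) : Prop :=
  ∀ p χ₁ q₁ χ₂ q₂, (p, χ₁, q₁) ∈ A.instr → (p, χ₂, q₂) ∈ A.instr →
    (χ₁, q₁) ≠ (χ₂, q₂) → gNegOf χ₁ χ₂ ∨ gNegOf χ₂ χ₁

/-- A configuration is halting if no step is possible from it. -/
def GHaltingConf {k : ℕ} (A : GWA Sig k) (g : LGraph Sig) (c : GConf A g) : Prop :=
  ∀ c', ¬ GStep A g c c'

/-- There is an accepting computation started with all heads on node `u`: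
it starts in the initial state with no pebbles, and halts in an accepting state
with no pebbles on the graph. -/
def AccFrom {k : ℕ} (A : GWA Sig k) (g : LGraph Sig) (u : g.V) : Prop :=
  ∃ (q : A.Q) (hs : Fin k → g.V), q ∈ A.acc ∧
    Relation.ReflTransGen (GStep A g) (A.q0, fun _ => u, []) (q, hs, []) ∧
    GHaltingConf A g (q, hs, [])

/-- `A` accepts `g`: for every choice of initial node there is an accepting
computation. -/
def GAccepts {k : ℕ} (A : GWA Sig k) (g : LGraph Sig) : Prop :=
  ∀ u : g.V, AccFrom A g u

/-- The restriction on automata: acceptance is independent of the initial node. -/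
def NodeIndependent {k : ℕ} (A : GWA Sig k) : Prop :=
  ∀ (g : LGraph Sig) (u₁ u₂ : g.V), AccFrom A g u₁ → AccFrom A g u₂

/-- The automaton uses no jump instructions (the basic model). -/
def NoJump {k : ℕ} (A : GWA Sig k) : Prop :=
  ∀ p χ q, (p, χ, q) ∈ A.instr → ∀ i x, χ ≠ GInstr.jump i x

/-- `DPTWA^k` within the family `F`: graph languages accepted by deterministic
`k`-head graph-walking automata with nested pebbles (no jump instructions). -/
def DPTWAg (Sig : Type) (F : Set (LGraph Sig)) (k : ℕ) : Set (Set (LGraph Sig)) :=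
  {L | ∃ A : GWA Sig k, GDeterministic A ∧ NoJump A ∧ NodeIndependent A ∧
        L = {g | g ∈ F ∧ GAccepts A g}}

/-- `DPTWA^k` within the family `F`, for the model extended with jump
instructions. -/
def DPTWAgJ (Sig : Type) (F : Set (LGraph Sig)) (k : ℕ) : Set (Set (LGraph Sig)) :=
  {L | ∃ A : GWA Sig k, GDeterministic A ∧ NodeIndependent A ∧
        L = {g | g ∈ F ∧ GAccepts A g}}

/-- `NPTWA^k` within the family `F`: graph languages accepted by nondeterministic
`k`-head graph-walking automata with nested pebbles (no jump instructions). -/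
def NPTWAg (Sig : Type) (F : Set (LGraph Sig)) (k : ℕ) : Set (Set (LGraph Sig)) :=
  {L | ∃ A : GWA Sig k, NoJump A ∧ NodeIndependent A ∧
        L = {g | g ∈ F ∧ GAccepts A g}}

/-- Started with all heads on node `u` of `g`, the (deterministic) automaton `A`
performs a walk that halts and during which every node of `g` is visited by some
head at least once. -/
def SearchesFrom {k : ℕ} (A : GWA Sig k) (g : LGraph Sig) (u : g.V) : Prop :=
  ∃ (n : ℕ) (cs : Fin (n + 1) → GConf A g),
    cs 0 = (A.q0, fun _ => u, []) ∧
    (∀ i : Fin n, GStep A g (cs i.castSucc) (cs i.succ)) ∧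
    GHaltingConf A g (cs (Fin.last n)) ∧
    ∀ v : g.V, ∃ (i : Fin (n + 1)) (h : Fin k), (cs i).2.1 h = v

/-- A family of graphs is `k`-searchable if some fixed deterministic `k`-head
graph-walking automaton with nested pebbles (a guide) traverses every graph of the
family from every initial node, visiting all nodes and halting. -/
def kSearchable (Sig : Type) (F : Set (LGraph Sig)) (k : ℕ) : Prop :=
  ∃ A : GWA Sig k, GDeterministic A ∧ NoJump A ∧
    ∀ g ∈ F, ∀ u : g.V, SearchesFrom A g u

/-- A family of graphs is searchable if it is `1`-searchable, i.e., some fixed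
single-head deterministic graph-walking automaton with nested pebbles traverses
every graph of the family. -/
def Searchable (Sig : Type) (F : Set (LGraph Sig)) : Prop :=
  kSearchable Sig F 1

/-- Replacing the node labels of a graph. -/
def relabel (g : LGraph Sig) (f : g.V → Sig) : LGraph Sig :=
  { g with nlab := f }

/-- Membership in the family does not depend on the node labels. -/
def NodeLabelInsensitive (F : Set (LGraph Sig)) : Prop :=
  ∀ g ∈ F, ∀ f : g.V → Sig, relabel g f ∈ F

end NestedPebblesGraphs

namespace NestedPebblesGraphs

/-! ### Semantic definability -/

section Definability

variable {k : ℕ} {I J : Type}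

/-- `R` is definable in FO+DTC^k, for every naming of its parameters by variables. -/
def Dfn (k : ℕ) (R : ∀ g : LGraph Sig, (I → g.V) → Prop) : Prop :=
  ∀ e : I → ℕ, ∃ φ : GForm Sig k, GWF φ ∧ GDetTC φ ∧ gfree φ ⊆ Set.range e ∧
    ∀ (g : LGraph Sig) (ν : ℕ → g.V), GSat g φ ν ↔ R g (fun i => ν (e i))

theorem Dfn.congr {R S : ∀ g : LGraph Sig, (I → g.V) → Prop} (h : Dfn k R)
    (hRS : ∀ g v, S g v ↔ R g v) : Dfn k S := by
  have : S = R := by funext g v; exact propext (hRS g v)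
  rw [this]; exact h

theorem Dfn.comp {R : ∀ g : LGraph Sig, (I → g.V) → Prop} (h : Dfn k R) (f : I → J) :
    Dfn k (fun g (v : J → g.V) => R g (fun i => v (f i))) := by
  intro e
  obtain ⟨φ, h1, h2, h3, h4⟩ := h (fun i => e (f i))
  refine ⟨φ, h1, h2, h3.trans ?_, h4⟩
  rintro _ ⟨i, rfl⟩
  exact ⟨f i, rfl⟩

theorem Dfn.not {R : ∀ g : LGraph Sig, (I → g.V) → Prop} (h : Dfn k R) :
    Dfn k (fun g v => ¬ R g v) := by
  intro e
  obtain ⟨φ, h1, h2, h3, h4⟩ := h e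
  exact ⟨.not φ, h1, h2, h3, fun g ν => by simp only [GSat, h4]⟩

theorem Dfn.and {R S : ∀ g : LGraph Sig, (I → g.V) → Prop} (h : Dfn k R) (h' : Dfn k S) :
    Dfn k (fun g v => R g v ∧ S g v) := by
  intro e
  obtain ⟨φ, h1, h2, h3, h4⟩ := h e
  obtain ⟨ψ, h1', h2', h3', h4'⟩ := h' e
  exact ⟨.and φ ψ, ⟨h1, h1'⟩, ⟨h2, h2'⟩, Set.union_subset h3 h3',
    fun g ν => by simp only [GSat, h4, h4']⟩

theorem Dfn.or {R S : ∀ g : LGraph Sig, (I → g.V) → Prop} (h : Dfn k R) (h' : Dfn k S) :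
    Dfn k (fun g v => R g v ∨ S g v) := by
  intro e
  obtain ⟨φ, h1, h2, h3, h4⟩ := h e
  obtain ⟨ψ, h1', h2', h3', h4'⟩ := h' e
  exact ⟨.or φ ψ, ⟨h1, h1'⟩, ⟨h2, h2'⟩, Set.union_subset h3 h3',
    fun g ν => by simp only [GSat, h4, h4']⟩

theorem Dfn.const (P : Prop) : Dfn k (fun (g : LGraph Sig) (_ : I → g.V) => P) := by
  intro e
  by_cases hP : P
  · exact ⟨.all 0 (.eq 0 0), trivial, trivial, by simp [gfree], fun g ν => by simp [GSat, hP]⟩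
  · exact ⟨.not (.all 0 (.eq 0 0)), trivial, trivial, by simp [gfree],
      fun g ν => by simp [GSat, hP]⟩

theorem Dfn.lab (a : Sig) (i : I) : Dfn k (fun g (v : I → g.V) => g.nlab (v i) = a) := by
  intro e
  refine ⟨.lab a (e i), trivial, trivial, ?_, fun g ν => by simp [GSat]⟩
  simp [gfree]

theorem Dfn.edg (a : Sig) (i j : I) : Dfn k (fun g (v : I → g.V) => g.edge a (v i) (v j)) := by
  intro e
  refine ⟨.edg a (e i) (e j), trivial, trivial, ?_, fun g ν => by simp [GSat]⟩
  simp [gfree, Set.insert_subset_iff]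

theorem Dfn.eq (i j : I) : Dfn k (fun (g : LGraph Sig) (v : I → g.V) => v i = v j) := by
  intro e
  refine ⟨.eq (e i) (e j), trivial, trivial, ?_, fun g ν => by simp [GSat]⟩
  simp [gfree, Set.insert_subset_iff]

theorem Dfn.exFinset {α : Type*} (s : Finset α) {R : α → ∀ g : LGraph Sig, (I → g.V) → Prop}
    (h : ∀ a ∈ s, Dfn k (R a)) : Dfn k (fun g v => ∃ a ∈ s, R a g v) := by
  classical
  induction s using Finset.induction_on with
  | empty => exact (Dfn.const False).congr (by simp)
  | insert a s _ ih =>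
    refine ((h a (by simp)).or (ih fun b hb => h b (by simp [hb]))).congr ?_
    intro g v
    simp

theorem Dfn.exFin {α : Type*} [Finite α] {R : α → ∀ g : LGraph Sig, (I → g.V) → Prop}
    (h : ∀ a, Dfn k (R a)) : Dfn k (fun g v => ∃ a, R a g v) := by
  have := Fintype.ofFinite α
  exact (Dfn.exFinset Finset.univ (fun a _ => h a)).congr (by simp)

theorem Dfn.allFin {α : Type*} [Finite α] {R : α → ∀ g : LGraph Sig, (I → g.V) → Prop}
    (h : ∀ a, Dfn k (R a)) : Dfn k (fun g v => ∀ a, R a g v) :=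
  (Dfn.exFin (fun a => (h a).not)).not.congr (by simp)

theorem exists_bound [Finite I] (e : I → ℕ) : ∃ N, ∀ i, e i < N := by
  have := Fintype.ofFinite I
  refine ⟨Finset.univ.sup e + 1, fun i => Nat.lt_succ_of_le (Finset.le_sup (Finset.mem_univ i))⟩

theorem Dfn.ex1 [Finite I] {R : ∀ g : LGraph Sig, (I → g.V) → g.V → Prop}
    (h : Dfn k (fun g (v : Option I → g.V) => R g (fun i => v (some i)) (v none))) :
    Dfn k (fun g v => ∃ u, R g v u) := by
  intro e
  obtain ⟨N, hN⟩ := exists_bound e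
  obtain ⟨φ, h1, h2, h3, h4⟩ := h (fun o => o.elim N e)
  refine ⟨.ex N φ, h1, h2, ?_, fun g ν => ?_⟩
  · rintro n ⟨hn, hn'⟩
    obtain ⟨o, rfl⟩ := h3 hn
    cases o with
    | none => exact absurd rfl hn'
    | some i => exact ⟨i, rfl⟩
  · simp only [GSat, h4, Option.elim]
    refine exists_congr fun u => ?_
    have : ∀ i, Function.update ν N u (e i) = ν (e i) := fun i =>
      Function.update_of_ne (hN i).ne _ _
    simp [this]

theorem Dfn.all1 [Finite I] {R : ∀ g : LGraph Sig, (I → g.V) → g.V → Prop}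
    (h : Dfn k (fun g (v : Option I → g.V) => R g (fun i => v (some i)) (v none))) :
    Dfn k (fun g v => ∀ u, R g v u) :=
  (Dfn.ex1 (R := fun g v u => ¬ R g v u) h.not).not.congr (by simp)

theorem Dfn.exs [Finite I] {n : ℕ} {R : ∀ g : LGraph Sig, (I → g.V) → (Fin n → g.V) → Prop}
    (h : Dfn k (fun g (v : I ⊕ Fin n → g.V) =>
      R g (fun i => v (Sum.inl i)) (fun i => v (Sum.inr i)))) :
    Dfn k (fun g v => ∃ c, R g v c) := by
  induction n with
  | zero =>
    refine (h.comp (Sum.elim id Fin.elim0)).congr fun g v => ?_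
    constructor
    · rintro ⟨c, hc⟩
      have e : c = fun i => v (Sum.elim id Fin.elim0 (Sum.inr i)) := funext fun i => i.elim0
      rw [e] at hc
      exact hc
    · intro hc; exact ⟨_, hc⟩
  | succ n ih =>
    have h' : Dfn k (fun g v => ∃ c : Fin n → g.V, ∃ u, R g v (Fin.cons u c)) := by
      apply ih
      apply Dfn.ex1 (R := fun g (v : I ⊕ Fin n → g.V) u =>
        R g (fun i => v (Sum.inl i)) (Fin.cons u (fun i => v (Sum.inr i))))
      refine (h.comp (J := Option (I ⊕ Fin n)) (Sum.elim (fun i => some (Sum.inl i))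
        (Fin.cons none (fun i => some (Sum.inr i))))).congr fun g v => ?_
      have : (Fin.cons (v none) (fun i => v (some (Sum.inr i))) : Fin (n+1) → g.V) =
        fun i => v ((Fin.cons none (fun i => some (Sum.inr i)) :
          Fin (n+1) → Option (I ⊕ Fin n)) i) := by
        funext i
        refine Fin.cases ?_ (fun j => ?_) i <;> simp
      rw [this]
      rfl
    refine h'.congr fun g v => ⟨?_, ?_⟩
    · rintro ⟨c, hc⟩
      exact ⟨Fin.tail c, c 0, by simpa using hc⟩
    · rintro ⟨c, u, hc⟩
      exact ⟨_, hc⟩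

theorem updVec_mem {α : Type} (ν : ℕ → α) {xs : Fin k → ℕ} (hx : Function.Injective xs)
    (a : Fin k → α) (i : Fin k) : updVec ν xs a (xs i) = a i := by
  have h : ∃ j, xs j = xs i := ⟨i, rfl⟩
  simp only [updVec, h, dif_pos]
  rw [hx h.choose_spec]

theorem updVec_not {α : Type} (ν : ℕ → α) {xs : Fin k → ℕ} (a : Fin k → α) (n : ℕ)
    (h : ∀ i, xs i ≠ n) : updVec ν xs a n = ν n := by
  have h : ¬ ∃ j, xs j = n := by rintro ⟨j, hj⟩; exact h j hj
  simp [updVec, h]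

/-- Conjoining trivial equations to make variables occur free. -/
theorem exists_free (φ : GForm Sig k) (l : List ℕ) :
    ∃ ψ : GForm Sig k, (GWF φ → GWF ψ) ∧ (GDetTC φ → GDetTC ψ) ∧
      gfree ψ = gfree φ ∪ {n | n ∈ l} ∧ ∀ (g : LGraph Sig) ν, GSat g ψ ν ↔ GSat g φ ν := by
  induction l with
  | nil => exact ⟨φ, id, id, by simp, fun _ _ => Iff.rfl⟩
  | cons n l ih =>
    obtain ⟨ψ, h1, h2, h3, h4⟩ := ih
    refine ⟨.and ψ (.eq n n), fun h => ⟨h1 h, trivial⟩, fun h => ⟨h2 h, trivial⟩, ?_, ?_⟩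
    · ext m
      simp [gfree, h3]
      tauto
    · intro g ν
      simp [GSat, h4]

theorem Dfn.tc [Finite I]
    {R : ∀ g : LGraph Sig, (I → g.V) → (Fin k → g.V) → (Fin k → g.V) → Prop}
    (h : Dfn k (fun g (v : I ⊕ Fin k ⊕ Fin k → g.V) =>
      R g (fun i => v (.inl i)) (fun i => v (.inr (.inl i))) (fun i => v (.inr (.inr i)))))
    (hf : ∀ g v a b b', R g v a b → R g v a b' → b = b') (us vs : Fin k → I) :
    Dfn k (fun g v => Relation.ReflTransGen (R g v) (fun i => v (us i)) (fun i => v (vs i))) := by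
  intro e
  obtain ⟨N, hN⟩ := exists_bound e
  set xs : Fin k → ℕ := fun i => N + i with hxs
  set ys : Fin k → ℕ := fun i => N + k + i with hys
  have hxi : Function.Injective xs := by
    intro i j hij
    simp only [hxs] at hij
    ext; omega
  have hyi : Function.Injective ys := by
    intro i j hij
    simp only [hys] at hij
    ext; omega
  have hxy : ∀ i j, xs i ≠ ys j := by
    intro i j
    simp only [hxs, hys]
    have := i.2
    omega
  have hxe : ∀ i j, xs i ≠ e j := by
    intro i j
    have := hN j
    simp only [hxs]
    omega
  have hye : ∀ i j, ys i ≠ e j := by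
    intro i j
    have := hN j
    simp only [hys]
    omega
  obtain ⟨φ, h1, h2, h3, h4⟩ := h (Sum.elim e (Sum.elim xs ys))
  obtain ⟨ψ, g1, g2, g3, g4⟩ := exists_free φ (List.ofFn xs ++ List.ofFn ys)
  have key : ∀ (g : LGraph Sig) (ν : ℕ → g.V) a b,
      GSat g ψ (updVec (updVec ν xs a) ys b) ↔ R g (fun i => ν (e i)) a b := by
    intro g ν a b
    rw [g4, h4]
    simp only [Sum.elim_inl, Sum.elim_inr]
    have e1 : (fun i => updVec (updVec ν xs a) ys b (e i)) = fun i => ν (e i) := by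
      funext i
      rw [updVec_not _ _ _ (fun j => hye j i), updVec_not _ _ _ (fun j => hxe j i)]
    have e2 : (fun i => updVec (updVec ν xs a) ys b (xs i)) = a := by
      funext i
      rw [updVec_not _ _ _ (fun j => (hxy i j).symm), updVec_mem _ hxi]
    have e3 : (fun i => updVec (updVec ν xs a) ys b (ys i)) = b := by
      funext i
      rw [updVec_mem _ hyi]
    rw [e1, e2, e3]
  refine ⟨.tc xs ys ψ (fun i => e (us i)) (fun i => e (vs i)),
    ⟨⟨hxi, hyi, hxy⟩, ?_, g1 h1⟩, ⟨?_, g2 h2⟩, ?_, ?_⟩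
  · rw [g3]
    rintro n (⟨i, rfl⟩ | ⟨i, rfl⟩) <;> right <;> simp [List.mem_ofFn]
  · intro g ν a b b' hb hb'
    rw [key] at hb hb'
    exact hf _ _ _ _ _ hb hb'
  · rintro n ((⟨hn, hn'⟩ | ⟨i, rfl⟩) | ⟨i, rfl⟩)
    · rw [g3] at hn
      rcases hn with hn | hn
      · obtain ⟨i | i | i, rfl⟩ := h3 hn
        · exact ⟨i, rfl⟩
        · exact absurd (Or.inl ⟨i, rfl⟩) hn'
        · exact absurd (Or.inr ⟨i, rfl⟩) hn'
      · exfalso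
        apply hn'
        simpa [List.mem_ofFn] using hn
    · exact ⟨_, rfl⟩
    · exact ⟨_, rfl⟩
  · intro g ν
    simp only [GSat, key]

end Definability

/-! ### Paths through a set of intermediate points -/

/-- Nonempty paths all of whose intermediate points satisfy `K`. -/
inductive Via {C : Type*} (R : C → C → Prop) (K : C → Prop) : C → C → Prop
  | base {a b} : R a b → Via R K a b
  | step {a c b} : R a c → K c → Via R K c b → Via R K a b

namespace Via

variable {C : Type*} {R : C → C → Prop} {K K' : C → Prop}

theorem func (hR : ∀ a b b', R a b → R a b' → b = b') {a b b' : C}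
    (h : Via R K a b) (h' : Via R K a b') (hb : ¬ K b) (hb' : ¬ K b') : b = b' := by
  induction h with
  | base h =>
    cases h' with
    | base h' => exact hR _ _ _ h h'
    | step h1 h2 _ => rw [hR _ _ _ h h1] at hb; exact absurd h2 hb
  | step h1 h2 _ ih =>
    cases h' with
    | base h' => rw [hR _ _ _ h' h1] at hb'; exact absurd h2 hb'
    | step h1' h2' h3' => rw [hR _ _ _ h1' h1] at h3'; exact ih h3' hb

theorem mono {a b : C} (h : Via R K a b) (hK : ∀ c, K c → K' c) : Via R K' a b := by
  induction h with
  | base h => exact .base h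
  | step h1 h2 _ ih => exact .step h1 (hK _ h2) ih

theorem trans {a c b : C} (h : Via R K a c) (hc : K c) (h' : Via R K c b) : Via R K a b := by
  induction h with
  | base h => exact .step h hc h'
  | step h1 h2 _ ih => exact .step h1 h2 (ih hc h')

theorem rtg {a b : C} (h : Via R K a b) : Relation.ReflTransGen R a b := by
  induction h with
  | base h => exact .single h
  | step h1 _ _ ih => exact .head h1 ih

end Via

theorem rtg_iff_via {C : Type*} {R : C → C → Prop} {K : C → Prop} (hK : ∀ c, K c) (a b : C) :
    Relation.ReflTransGen R a b ↔ a = b ∨ Via R K a b := by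
  constructor
  · intro h
    induction h using Relation.ReflTransGen.head_induction_on with
    | refl => exact .inl rfl
    | head h _ ih =>
      rcases ih with rfl | ih
      · exact .inr (.base h)
      · exact .inr (.step h (hK _) ih)
  · rintro (rfl | h)
    · exact .refl
    · exact h.rtg

theorem via_insert {Q W : Type*} [DecidableEq Q] {R : Q × W → Q × W → Prop} (r : Q) (K : Finset Q)
    (a b : Q × W) :
    Via R (fun c => c.1 ∈ insert r K) a b ↔ Via R (fun c => c.1 ∈ K) a b ∨
      ∃ c d, Via R (fun c => c.1 ∈ K) a (r, c) ∧
        Relation.ReflTransGen (fun c d => Via R (fun c => c.1 ∈ K) (r, c) (r, d)) c d ∧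
        Via R (fun c => c.1 ∈ K) (r, d) b := by
  have hm : ∀ c : Q × W, c.1 ∈ K → c.1 ∈ insert r K := fun c h => Finset.mem_insert_of_mem h
  constructor
  · intro h
    induction h with
    | base h => exact .inl (.base h)
    | @step a c b h1 h2 _ ih =>
      rcases Finset.mem_insert.1 h2 with hc | hc
      · right
        obtain ⟨q, c⟩ := c
        obtain rfl : q = r := hc
        rcases ih with ih | ⟨c', d, i1, i2, i3⟩
        · exact ⟨c, c, .base h1, .refl, ih⟩
        · exact ⟨c, d, .base h1, .head i1 i2, i3⟩
      · rcases ih with ih | ⟨c', d, i1, i2, i3⟩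
        · exact .inl (.step h1 hc ih)
        · exact .inr ⟨c', d, .step h1 hc i1, i2, i3⟩
  · rintro (h | ⟨c, d, i1, i2, i3⟩)
    · exact h.mono hm
    · have hr : ∀ c : W, (r, c).1 ∈ insert r K := fun c => Finset.mem_insert_self _ _
      refine (i1.mono hm).trans (hr c) ?_
      clear i1
      induction i2 using Relation.ReflTransGen.head_induction_on with
      | refl => exact i3.mono hm
      | head h _ ih => exact (h.mono hm).trans (hr _) ih

/-! ### Kleene construction -/

section Kleene

variable {k : ℕ} {P Q : Type}

/-- Definability of a family of relations on `Q × V^k` with parameters `P`. -/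
def RDef (k : ℕ)
    (R : ∀ g : LGraph Sig, (P → g.V) → Q × (Fin k → g.V) → Q × (Fin k → g.V) → Prop) : Prop :=
  ∀ p q, Dfn k (fun g (v : P ⊕ Fin k ⊕ Fin k → g.V) =>
    R g (fun i => v (.inl i)) (p, fun i => v (.inr (.inl i))) (q, fun i => v (.inr (.inr i))))

variable {R : ∀ g : LGraph Sig, (P → g.V) → Q × (Fin k → g.V) → Q × (Fin k → g.V) → Prop}

theorem RDef.use {I : Type} (h : RDef k R) (p q : Q) (w : P → I) (a b : Fin k → I) :
    Dfn k (fun g (v : I → g.V) =>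
      R g (fun i => v (w i)) (p, fun i => v (a i)) (q, fun i => v (b i))) :=
  (h p q).comp (Sum.elim w (Sum.elim a b))

theorem RDef.via [Finite P] [DecidableEq Q] (h : RDef k R)
    (hf : ∀ g w a b b', R g w a b → R g w a b' → b = b') (K : Finset Q) :
    RDef k (fun g w => Via (R g w) (fun c => c.1 ∈ K)) := by
  induction K using Finset.induction_on with
  | empty =>
    intro p q
    refine (h p q).congr fun g v => ⟨?_, .base⟩
    rintro (h | ⟨_, h, _⟩)
    · exact h
    · simp at h
  | insert r K hr ih =>
    intro p q
    refine Dfn.congr ?_ (fun g v => via_insert r K _ _)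
    refine (ih p q).or ?_
    apply Dfn.exs (R := fun g (v : P ⊕ Fin k ⊕ Fin k → g.V) c => ∃ d,
      Via (R g fun i => v (.inl i)) (fun c => c.1 ∈ K) (p, fun i => v (.inr (.inl i))) (r, c) ∧
        Relation.ReflTransGen
          (fun c d => Via (R g fun i => v (.inl i)) (fun c => c.1 ∈ K) (r, c) (r, d)) c d ∧
        Via (R g fun i => v (.inl i)) (fun c => c.1 ∈ K) (r, d) (q, fun i => v (.inr (.inr i))))
    apply Dfn.exs (R := fun g (v : (P ⊕ Fin k ⊕ Fin k) ⊕ Fin k → g.V) d =>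
      Via (R g fun i => v (.inl (.inl i))) (fun c => c.1 ∈ K)
        (p, fun i => v (.inl (.inr (.inl i)))) (r, fun i => v (.inr i)) ∧
        Relation.ReflTransGen
          (fun c d => Via (R g fun i => v (.inl (.inl i))) (fun c => c.1 ∈ K) (r, c) (r, d))
          (fun i => v (.inr i)) d ∧
        Via (R g fun i => v (.inl (.inl i))) (fun c => c.1 ∈ K) (r, d)
          (q, fun i => v (.inl (.inr (.inr i)))))
    refine (ih.use p r _ _ _).and (Dfn.and ?_ (ih.use r q _ _ _))
    refine Dfn.tc (R := fun g (v : ((P ⊕ Fin k ⊕ Fin k) ⊕ Fin k) ⊕ Fin k → g.V) c d =>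
      Via (R g fun i => v (.inl (.inl (.inl i)))) (fun c => c.1 ∈ K) (r, c) (r, d)) ?_ ?_ _ _
    · exact ih.use r r _ _ _
    · intro g v a b b' h1 h2
      have := Via.func (hf g _) h1 h2 hr hr
      exact (Prod.mk.inj this).2

theorem RDef.rtg [Finite P] [Finite Q] (h : RDef k R)
    (hf : ∀ g w a b b', R g w a b → R g w a b' → b = b') :
    RDef k (fun g w => Relation.ReflTransGen (R g w)) := by
  classical
  have := Fintype.ofFinite Q
  intro p q
  refine Dfn.congr ?_ (fun g v => rtg_iff_via (K := fun c => c.1 ∈ (Finset.univ : Finset Q))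
    (by simp) _ _)
  refine Dfn.or ?_ (h.via hf Finset.univ p q)
  refine ((Dfn.const (p = q)).and (Dfn.allFin (α := Fin k) (fun i =>
    Dfn.eq (.inr (.inl i)) (.inr (.inr i))))).congr fun g v => ?_
  simp [funext_iff]

end Kleene

/-! ### BigStep steps of automata -/

section Automata

variable {k : ℕ} (A : GWA Sig k)

/-- BigStep steps on stack `π`: a step not changing the stack, or a whole excursion that drops a
pebble, computes above it, and retrieves it. -/
def BigStep (g : LGraph Sig) : ℕ → List (A.X × g.V) →
    A.Q × (Fin k → g.V) → A.Q × (Fin k → g.V) → Prop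
  | 0, π, c, c' => ∃ ins, (c.1, ins, c'.1) ∈ A.instr ∧ gInstrStep g ins c.2 π c'.2 π
  | n + 1, π, c, c' =>
    (∃ ins, (c.1, ins, c'.1) ∈ A.instr ∧ gInstrStep g ins c.2 π c'.2 π) ∨
    ∃ i x p q, (c.1, GInstr.dropPeb i x, p) ∈ A.instr ∧ (∀ w, (x, w) ∉ π) ∧
      (q, GInstr.retrieve x, c'.1) ∈ A.instr ∧
      Relation.ReflTransGen (BigStep g n ((x, c.2 i) :: π)) (p, c.2) (q, c'.2)

variable {A}

theorem BigStep.flat {g : LGraph Sig} {n : ℕ} {π : List (A.X × g.V)}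
    {c c' : A.Q × (Fin k → g.V)}
    (h : ∃ ins, (c.1, ins, c'.1) ∈ A.instr ∧ gInstrStep g ins c.2 π c'.2 π) :
    BigStep A g n π c c' := by
  cases n with
  | zero => exact h
  | succ n => exact .inl h

theorem BigStep.via {g : LGraph Sig} {n : ℕ} {π : List (A.X × g.V)}
    {c c' : A.Q × (Fin k → g.V)} (h : BigStep A g n π c c') :
    Via (GStep A g) (fun d => π.length < d.2.2.length) (c.1, c.2, π) (c'.1, c'.2, π) := by
  induction n generalizing π c c' with
  | zero =>
    exact .base h
  | succ n ih =>
    rcases h with h | ⟨i, x, p, q, h1, h2, h3, h4⟩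
    · exact .base h
    · refine .step (c := (p, c.2, (x, c.2 i) :: π)) ⟨_, h1, rfl, rfl, h2⟩ (by simp) ?_
      have last : ∀ d : Fin k → g.V, Via (GStep A g) (fun d => π.length < d.2.2.length)
          (q, d, (x, c.2 i) :: π) (c'.1, d, π) :=
        fun d => .base ⟨_, h3, rfl, _, rfl⟩
      suffices H : ∀ d : A.Q × (Fin k → g.V),
          Relation.ReflTransGen (BigStep A g n ((x, c.2 i) :: π)) d (q, c'.2) →
          Via (GStep A g) (fun d => π.length < d.2.2.length)
            (d.1, d.2, (x, c.2 i) :: π) (c'.1, c'.2, π) from H _ h4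
      intro d hd
      induction hd using Relation.ReflTransGen.head_induction_on with
      | refl => exact last _
      | head h _ ih' =>
        refine ((ih h).mono ?_).trans (by simp) ih'
        intro e he
        simp only [List.length_cons] at he
        omega

theorem step_func (hd : GDeterministic A) (hj : NoJump A) (g : LGraph Sig)
    (a b b' : GConf A g) (h : GStep A g a b) (h' : GStep A g a b') : b = b' := by
  obtain ⟨p, hs, π⟩ := a
  obtain ⟨q, hs1, π1⟩ := b
  obtain ⟨q', hs2, π2⟩ := b'
  obtain ⟨ins, m, s⟩ := h
  obtain ⟨ins', m', s'⟩ := h'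
  simp only at m m' s s'
  by_cases hne : (ins, q) = (ins', q')
  · obtain ⟨rfl, rfl⟩ := Prod.mk.inj hne
    have mv : ∀ i, hs1 i = hs2 i → (∀ h, h ≠ i → hs1 h = hs h) → (∀ h, h ≠ i → hs2 h = hs h) →
        hs1 = hs2 := by
      intro i h1 h2 h3
      funext j
      by_cases hji : j = i
      · rw [hji, h1]
      · rw [h2 j hji, h3 j hji]
    cases ins with
    | inmove i a =>
      obtain ⟨rfl, e, f⟩ := s
      obtain ⟨rfl, e', f'⟩ := s'
      rw [mv i (g.in_unique _ _ _ _ e e') f f']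
    | outmove i a =>
      obtain ⟨rfl, e, f⟩ := s
      obtain ⟨rfl, e', f'⟩ := s'
      rw [mv i (g.out_unique _ _ _ _ e e') f f']
    | dropPeb i x =>
      obtain ⟨rfl, rfl, _⟩ := s
      obtain ⟨rfl, rfl, _⟩ := s'
      rfl
    | retrieve x =>
      obtain ⟨rfl, w, rfl⟩ := s
      obtain ⟨rfl, w', e⟩ := s'
      rw [(List.cons.inj e).2]
    | jump i x => exact absurd rfl (hj _ _ _ m i x)
    | test b τ =>
      obtain ⟨rfl, rfl, _⟩ := s
      obtain ⟨rfl, rfl, _⟩ := s'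
      rfl
  · exfalso
    rcases hd _ _ _ _ _ m m' hne with ⟨b, τ, rfl, rfl⟩ | ⟨b, τ, rfl, rfl⟩ <;>
    · have t := s.2.2
      have t' := s'.2.2
      cases b <;> simp_all

theorem BigStep.func (hd : GDeterministic A) (hj : NoJump A) {g : LGraph Sig} {n : ℕ}
    {π : List (A.X × g.V)} {c d d' : A.Q × (Fin k → g.V)}
    (h : BigStep A g n π c d) (h' : BigStep A g n π c d') : d = d' := by
  have := Via.func (step_func hd hj g) h.via h'.via (by simp) (by simp)
  simp only [Prod.mk.injEq, and_true] at this
  exact Prod.ext this.1 this.2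

/-- The computation finishes from the given configuration, decomposed into big steps. -/
def Finishes (A : GWA Sig k) (g : LGraph Sig) (N : ℕ) (f : A.Q × (Fin k → g.V)) :
    List (A.X × g.V) → A.Q × (Fin k → g.V) → Prop
  | [], c => Relation.ReflTransGen (BigStep A g N []) c f
  | (x, u) :: π, c => ∃ d q,
      Relation.ReflTransGen (BigStep A g (N - (π.length + 1)) ((x, u) :: π)) c d ∧
      (d.1, GInstr.retrieve x, q) ∈ A.instr ∧ Finishes A g N f π (q, d.2)

theorem Finishes.cons {g : LGraph Sig} {N : ℕ} {f : A.Q × (Fin k → g.V)} {π : List (A.X × g.V)}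
    {c d : A.Q × (Fin k → g.V)} (h : BigStep A g (N - π.length) π c d) (h' : Finishes A g N f π d) :
    Finishes A g N f π c := by
  cases π with
  | nil => exact Relation.ReflTransGen.head h h'
  | cons y π =>
    obtain ⟨x, u⟩ := y
    obtain ⟨e, q, h1, h2⟩ := h'
    exact ⟨e, q, .head h h1, h2⟩

theorem fin_of_rtg {g : LGraph Sig} (f : A.Q × (Fin k → g.V)) (c : GConf A g)
    (h : Relation.ReflTransGen (GStep A g) c (f.1, f.2, []))
    (hc : (c.2.2.map Prod.fst).Nodup) : Finishes A g (Nat.card A.X) f c.2.2 (c.1, c.2.1) := by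
  have := A.finX
  induction h using Relation.ReflTransGen.head_induction_on with
  | refl => exact Relation.ReflTransGen.refl
  | @head a b hab _ ih =>
    obtain ⟨p, hs, π⟩ := a
    obtain ⟨q, hs', π'⟩ := b
    obtain ⟨ins, m, s⟩ := hab
    simp only at m s hc ih ⊢
    have flat : π' = π → Finishes A g (Nat.card A.X) f π (p, hs) := by
      rintro rfl
      exact (ih hc).cons (BigStep.flat ⟨ins, m, s⟩)
    cases ins with
    | inmove i a => exact flat s.1
    | outmove i a => exact flat s.1
    | jump i a => exact flat s.1
    | test i a => exact flat s.2.1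
    | retrieve x =>
      obtain ⟨rfl, w, rfl⟩ := s
      exact ⟨(p, hs'), q, .refl, m, ih (by simp at hc; exact hc.2)⟩
    | dropPeb i x =>
      obtain ⟨rfl, rfl, hx⟩ := s
      have nd : ((((x, hs' i) :: π : List (A.X × g.V))).map Prod.fst).Nodup := by
        simp only [List.map_cons, List.nodup_cons]
        refine ⟨?_, hc⟩
        simpa using hx
      obtain ⟨d, r, h1, h2, h3⟩ := ih nd
      refine h3.cons ?_
      have hl : π.length + 1 ≤ Nat.card A.X := by
        have := nd.length_le_card
        simpa [Nat.card_eq_fintype_card] using this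
      obtain ⟨j, hj⟩ := Nat.exists_eq_add_of_le hl
      have e1 : Nat.card A.X - π.length = j + 1 := by omega
      have e2 : Nat.card A.X - (π.length + 1) = j := by omega
      rw [e1]
      rw [e2] at h1
      exact .inr ⟨i, x, q, d.1, m, hx, h2, h1⟩

theorem rtg_iff (g : LGraph Sig) (c f : A.Q × (Fin k → g.V)) :
    Relation.ReflTransGen (GStep A g) (c.1, c.2, []) (f.1, f.2, []) ↔
      Relation.ReflTransGen (BigStep A g (Nat.card A.X) []) c f := by
  constructor
  · intro h
    exact fin_of_rtg f _ h (by simp)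
  · intro h
    induction h with
    | refl => exact .refl
    | tail _ h ih => exact ih.trans h.via.rtg

/-! ### Definability of big steps -/

/-- The stack of shape `s` with positions `w`. -/
def stk {g : LGraph Sig} {X : Type} (s : List X) (w : X → g.V) : List (X × g.V) :=
  s.map (fun x => (x, w x))

theorem mem_stk {g : LGraph Sig} {X : Type} (s : List X) (w : X → g.V) (x : X) (u : g.V) :
    (x, u) ∈ stk s w ↔ x ∈ s ∧ u = w x := by
  simp only [stk, List.mem_map, Prod.mk.injEq]
  constructor
  · rintro ⟨y, h, rfl, rfl⟩; exact ⟨h, rfl⟩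
  · rintro ⟨h, rfl⟩; exact ⟨x, h, rfl, rfl⟩

theorem flat_dfn {X : Type} [Finite X] (ins : GInstr Sig k X) (s : List X) :
    Dfn k (fun g (v : X ⊕ Fin k ⊕ Fin k → g.V) =>
      gInstrStep g ins (fun i => v (.inr (.inl i))) (stk s fun x => v (.inl x))
        (fun i => v (.inr (.inr i))) (stk s fun x => v (.inl x))) := by
  have rest : ∀ i : Fin k, Dfn k (fun (g : LGraph Sig) (v : X ⊕ Fin k ⊕ Fin k → g.V) =>
      ∀ h, h ≠ i → v (.inr (.inr h)) = v (.inr (.inl h))) := by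
    intro i
    refine Dfn.allFin fun h => ?_
    refine ((Dfn.const (h = i)).or (Dfn.eq (.inr (.inr h)) (.inr (.inl h)))).congr fun g v => ?_
    tauto
  cases ins with
  | inmove i a =>
    exact ((Dfn.edg a (.inr (.inr i)) (.inr (.inl i))).and (rest i)).congr fun g v => by
      simp [gInstrStep]
  | outmove i a =>
    exact ((Dfn.edg a (.inr (.inl i)) (.inr (.inr i))).and (rest i)).congr fun g v => by
      simp [gInstrStep]
  | dropPeb i x => exact (Dfn.const False).congr fun g v => by simp [gInstrStep]
  | retrieve x => exact (Dfn.const False).congr fun g v => by simp [gInstrStep]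
  | jump i x =>
    exact (((Dfn.const (x ∈ s)).and (Dfn.eq (.inr (.inr i)) (.inl x))).and (rest i)).congr
      fun g v => by simp [gInstrStep, mem_stk]
  | test b τ =>
    have ht : Dfn k (fun g (v : X ⊕ Fin k ⊕ Fin k → g.V) =>
        gTestHolds g τ (fun i => v (.inr (.inl i))) (stk s fun x => v (.inl x))) := by
      cases τ with
      | lab i a => exact Dfn.lab a _
      | inedge i a =>
        exact Dfn.ex1 (R := fun g (v : X ⊕ Fin k ⊕ Fin k → g.V) u => g.edge a u (v (Sum.inr (Sum.inl i))))
          (Dfn.edg a none (some (Sum.inr (Sum.inl i))))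
      | outedge i a =>
        exact Dfn.ex1 (R := fun g (v : X ⊕ Fin k ⊕ Fin k → g.V) u => g.edge a (v (Sum.inr (Sum.inl i))) u)
          (Dfn.edg a (some (Sum.inr (Sum.inl i))) none)
      | peb i x =>
        exact ((Dfn.const (x ∈ s)).and (Dfn.eq (.inr (.inl i)) (.inl x))).congr
          fun g v => by simp [gTestHolds, mem_stk]
    have hh : Dfn k (fun (g : LGraph Sig) (v : X ⊕ Fin k ⊕ Fin k → g.V) =>
        ∀ h, v (.inr (.inr h)) = v (.inr (.inl h))) := Dfn.allFin fun h => Dfn.eq _ _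
    cases b with
    | true => exact (hh.and ht).congr fun g v => by simp [gInstrStep, funext_iff]
    | false => exact (hh.and ht.not).congr fun g v => by simp [gInstrStep, funext_iff]

theorem exInstr {I : Type} {R : GInstr Sig k A.X → A.Q → ∀ g : LGraph Sig, (I → g.V) → Prop}
    (h : ∀ ins q, Dfn k (R ins q)) (p : A.Q) :
    Dfn k (fun g v => ∃ ins q, (p, ins, q) ∈ A.instr ∧ R ins q g v) := by
  refine (Dfn.exFinset A.instrFin.toFinset (R := fun t g v => t.1 = p ∧ R t.2.1 t.2.2 g v)
    (fun t _ => (Dfn.const _).and (h _ _))).congr fun g v => ?_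
  simp only [Set.Finite.mem_toFinset]
  constructor
  · rintro ⟨ins, q, h1, h2⟩; exact ⟨_, h1, rfl, h2⟩
  · rintro ⟨⟨p', ins, q⟩, h1, rfl, h2⟩; exact ⟨ins, q, h1, h2⟩

theorem flat_rdef (s : List A.X) : RDef k (P := A.X) (Q := A.Q) (fun g w c c' =>
    ∃ ins, (c.1, ins, c'.1) ∈ A.instr ∧ gInstrStep g ins c.2 (stk s w) c'.2 (stk s w)) := by
  have := A.finX
  intro p q
  refine (exInstr (A := A) (R := fun ins q' g v => q' = q ∧ gInstrStep g ins
    (fun i => v (.inr (.inl i))) (stk s fun x => v (.inl x))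
        (fun i => v (.inr (.inr i))) (stk s fun x => v (.inl x)))
    (fun ins q' => (Dfn.const _).and (flat_dfn ins s)) p).congr fun g v => ?_
  constructor
  · rintro ⟨ins, h1, h2⟩; exact ⟨ins, q, h1, rfl, h2⟩
  · rintro ⟨ins, _, h1, rfl, h2⟩; exact ⟨ins, h1, h2⟩

theorem bigstep_rdef (hd : GDeterministic A) (hj : NoJump A) (n : ℕ) (s : List A.X) :
    RDef k (P := A.X) (Q := A.Q) (fun g w => BigStep A g n (stk s w)) := by
  classical
  have := A.finX
  have := A.finQ
  induction n generalizing s with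
  | zero => exact flat_rdef s
  | succ n ih =>
    intro p q
    refine Dfn.or (flat_rdef s p q) ?_
    have key : ∀ (i : Fin k) (x : A.X) (p' q' : A.Q),
        Dfn k (fun g (v : A.X ⊕ Fin k ⊕ Fin k → g.V) =>
          ((p, GInstr.dropPeb i x, p') ∈ A.instr ∧ x ∉ s ∧ (q', GInstr.retrieve x, q) ∈ A.instr) ∧
          Relation.ReflTransGen
            (BigStep A g n (stk (x :: s)
              (fun y => v (if y = x then .inr (.inl i) else .inl y))))
            (p', fun i => v (.inr (.inl i))) (q', fun i => v (.inr (.inr i)))) := by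
      intro i x p' q'
      refine (Dfn.const _).and ?_
      exact ((ih (x :: s)).rtg (fun g w a b b' => BigStep.func hd hj)).use p' q'
        (fun y => if y = x then Sum.inr (Sum.inl i) else Sum.inl y)
        (fun i => Sum.inr (Sum.inl i)) (fun i => Sum.inr (Sum.inr i))
    refine (Dfn.exFin fun i => Dfn.exFin fun x => Dfn.exFin fun p' => Dfn.exFin fun q' =>
      key i x p' q').congr fun g v => ?_
    refine exists_congr fun i => exists_congr fun x => exists_congr fun p' =>
      exists_congr fun q' => ?_
    have e1 : (∀ w, (x, w) ∉ stk (g := g) s fun x => v (.inl x)) ↔ x ∉ s := by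
      simp [mem_stk]
    simp only [e1, and_assoc]
    refine and_congr_right fun _ => and_congr_right fun hx => and_congr_right fun _ => ?_
    have e2 : stk (g := g) (x :: s) (fun y => v (if y = x then .inr (.inl i) else .inl y)) =
        (x, v (.inr (.inl i))) :: stk s fun x => v (.inl x) := by
      simp only [stk, List.map_cons, if_true, List.cons.injEq, true_and]
      refine List.map_congr_left fun y hy => ?_
      have : y ≠ x := fun h => hx (h ▸ hy)
      simp [this]
    rw [e2]

theorem halting_dfn (hk : 1 ≤ k) (q : A.Q) :
    Dfn k (fun g (v : Fin k → g.V) => GHaltingConf A g (q, v, [])) := by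
  have := A.finX
  have key : ∀ ins : GInstr Sig k A.X, Dfn k (fun g (v : Fin k → g.V) =>
      ∃ hs', gInstrStep g ins v [] hs' []) := by
    intro ins
    apply Dfn.exs (R := fun g v hs' => gInstrStep g ins v [] hs' [])
    exact (flat_dfn ins []).comp (J := Fin k ⊕ Fin k)
      (Sum.elim (fun _ => Sum.inl ⟨0, hk⟩) (Sum.elim Sum.inl Sum.inr))
  refine ((exInstr (A := A) (R := fun ins _ g v => (∃ hs', gInstrStep g ins v [] hs' []) ∨
    ∃ i x, ins = .dropPeb i x) (fun ins _ => (key ins).or (Dfn.const _)) q).not).congr fun g v => ?_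
  constructor
  · rintro h ⟨ins, q', m, ⟨hs', s⟩ | ⟨i, x, rfl⟩⟩
    · exact h (q', hs', []) ⟨ins, m, s⟩
    · exact h (q', v, [(x, v i)]) ⟨_, m, rfl, rfl, by simp⟩
  · rintro h ⟨q', hs', π'⟩ ⟨ins, m, s⟩
    simp only at m s
    refine h ⟨ins, q', m, ?_⟩
    cases ins with
    | inmove i a => left; obtain ⟨rfl, _⟩ := id s; exact ⟨hs', s⟩
    | outmove i a => left; obtain ⟨rfl, _⟩ := id s; exact ⟨hs', s⟩
    | jump i x => left; obtain ⟨rfl, _⟩ := id s; exact ⟨hs', s⟩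
    | test b τ => left; obtain ⟨_, rfl, _⟩ := id s; exact ⟨hs', s⟩
    | retrieve x => obtain ⟨_, w, hw⟩ := s; simp at hw
    | dropPeb i x => exact .inr ⟨i, x, rfl⟩

theorem accepts_dfn (hk : 1 ≤ k) (hd : GDeterministic A) (hj : NoJump A) :
    Dfn k (fun g (_ : Empty → g.V) => GAccepts A g) := by
  have := A.finX
  have := A.finQ
  apply Dfn.all1 (R := fun g (_ : Empty → g.V) u => AccFrom A g u)
  apply Dfn.exFin (R := fun q g (v : Option Empty → g.V) => ∃ hs : Fin k → g.V, q ∈ A.acc ∧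
    Relation.ReflTransGen (GStep A g) (A.q0, fun _ => v none, []) (q, hs, []) ∧
    GHaltingConf A g (q, hs, []))
  intro q
  apply Dfn.exs (R := fun g (v : Option Empty → g.V) hs => q ∈ A.acc ∧
    Relation.ReflTransGen (GStep A g) (A.q0, fun _ => v none, []) (q, hs, []) ∧
    GHaltingConf A g (q, hs, []))
  refine (Dfn.const _).and (Dfn.and ?_ ((halting_dfn hk q).comp _))
  refine Dfn.congr ?_ (fun g v => rtg_iff g (A.q0, fun _ => v (.inl none))
    (q, fun i => v (.inr i)))
  exact ((bigstep_rdef hd hj (Nat.card A.X) []).rtg (fun g w a b b' => BigStep.func hd hj)).use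
    A.q0 q (fun _ => Sum.inl none) (fun _ => Sum.inl none) (fun i => Sum.inr i)

end Automata

/-- For every family of graphs and every `k ≥ 1`,
`DPTWA^k ⊆ FO+DTC^k`: every graph language accepted by a deterministic `k`-head
graph-walking automaton with nested pebbles is definable in first-order logic
with `k`-ary deterministic transitive closure. -/
theorem DPTWAg_subset_FODTCg (Sig : Type) [Fintype Sig] (F : Set (LGraph Sig))
    (k : ℕ) (hk : 1 ≤ k) :
    DPTWAg Sig F k ⊆ FODTCg Sig F k := by
  rintro L ⟨A, hd, hj, _, rfl⟩
  obtain ⟨φ, h1, h2, h3, h4⟩ := accepts_dfn hk hd hj Empty.elim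
  refine ⟨φ, h1, h2, ?_, ?_⟩
  · rw [Set.range_eq_empty] at h3
    exact Set.subset_empty_iff.1 h3
  · ext g
    refine and_congr_right fun _ => ⟨fun h ν => (h4 g ν).2 h, fun h => ?_⟩
    obtain ⟨u⟩ := g.neV
    exact (h4 g fun _ => u).1 (h _)

end NestedPebblesGraphs
end
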